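/- arXiv:2107.06976 — 7 statements merged into one kernel-verified Lean document; each statement's English description precedes it below -/
import Mathlib

section
/- Let q ≥ 5 be a prime number and let G = C_3 ⊕ C_{3q} (concretely, G = (ℤ/3ℤ) × (ℤ/3qℤ)). Then c_0(G) = 3q + 3, i.e., 3q + 3 is the smallest integer t such that every regular sequence over G of length at least t is an additive basis of G. -/
open Multiset

/-- `subSums S` is Σ(S): the set of all sums of nonempty subsequences of `S`. -/
def subSums {G : Type*} [AddCommMonoid G] (S : Multiset G) : Set G :=
  {x | ∃ T : Multiset G, T ≤ S ∧ T ≠ 0 ∧ T.sum = x}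

open scoped Classical in
/-- A sequence `S` over `G` is regular if for every proper subgroup `H` of `G`,
`S` contains at most `|H| - 1` terms from `H`. -/
noncomputable def IsRegularSeq {G : Type*} [AddCommGroup G] (S : Multiset G) : Prop :=
  ∀ H : AddSubgroup G, H ≠ ⊤ →
    Multiset.card (S.filter (fun x => x ∈ H)) ≤ Nat.card H - 1

theorem exists_le_card_eq {α : Type*} (S : Multiset α) {n : ℕ} (h : n ≤ card S) :
    ∃ T ≤ S, card T = n := by
  have h1 : 0 < card (powersetCard n S) := by
    rw [card_powersetCard]
    exact Nat.choose_pos h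
  obtain ⟨T, hT⟩ := card_pos_iff_exists_mem.1 h1
  exact ⟨T, mem_powersetCard.1 hT⟩

theorem exists_map_eq_of_le_map {α β : Type*} {f : α → β} {S : Multiset α} {T : Multiset β}
    (h : T ≤ S.map f) : ∃ U ≤ S, U.map f = T := by
  have h1 : T ∈ powersetCard (card T) (S.map f) := mem_powersetCard.2 ⟨h, rfl⟩
  rw [powersetCard_map, mem_map] at h1
  obtain ⟨U, hU, rfl⟩ := h1
  exact ⟨U, (mem_powersetCard.1 hU).1, rfl⟩

theorem exists_add_eq_of_le_add {α : Type*} {S A B : Multiset α} (h : S ≤ A + B) :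
    ∃ U ≤ A, ∃ V ≤ B, U + V = S := by
  classical
  refine ⟨S ∩ A, inter_le_right, S - A, tsub_le_iff_left.2 h, ?_⟩
  rw [add_comm, Multiset.sub_add_inter]

open scoped Pointwise in
/-- Subsequence sums of `n` nonzero residues modulo a prime `q` take at least `min q (n + 1)`
values. -/
theorem exists_finset_subsequence_sums {q : ℕ} (hq : q.Prime) (M : Multiset (ZMod q))
    (h0 : 0 ∉ M) :
    ∃ A : Finset (ZMod q), min q (card M + 1) ≤ A.card ∧ ∀ z ∈ A, ∃ T ≤ M, T.sum = z := by
  have := Fact.mk hq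
  induction M using Multiset.induction_on with
  | empty =>
    exact ⟨{0}, by simp, fun z hz =>
      ⟨0, le_rfl, by rw [sum_zero, Finset.mem_singleton.1 hz]⟩⟩
  | cons a M ih =>
    rw [mem_cons, not_or] at h0
    obtain ⟨A, hA, hAM⟩ := ih h0.2
    have hne : A.Nonempty := by
      rw [← Finset.card_pos]
      have := hq.pos
      omega
    have hcard : ({0, a} : Finset (ZMod q)).card = 2 := Finset.card_pair h0.1
    refine ⟨A + ({0, a} : Finset (ZMod q)), ?_, ?_⟩
    · have := ZMod.cauchy_davenport hq hne (t := ({0, a} : Finset (ZMod q))) (by simp)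
      rw [card_cons]
      omega
    · intro z hz
      obtain ⟨x, hx, y, hy, rfl⟩ := Finset.mem_add.1 hz
      obtain ⟨T, hT, rfl⟩ := hAM x hx
      rcases Finset.mem_insert.1 hy with rfl | hy
      · exact ⟨T, hT.trans (le_cons_self _ _), by simp⟩
      · rw [Finset.mem_singleton] at hy
        subst hy
        exact ⟨y ::ₘ T, cons_le_cons _ hT, by rw [sum_cons, add_comm]⟩

theorem exists_le_sum_eq_of_card {q : ℕ} (hq : q.Prime) (M : Multiset (ZMod q)) (h0 : 0 ∉ M)
    (hM : q - 1 ≤ card M) (z : ZMod q) : ∃ T ≤ M, T.sum = z := by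
  have := Fact.mk hq
  obtain ⟨A, hA, hAM⟩ := exists_finset_subsequence_sums hq M h0
  apply hAM
  have : A = Finset.univ := by
    rw [← Finset.card_eq_iff_eq_univ, ZMod.card]
    have := A.card_le_univ
    rw [ZMod.card] at this
    have := hq.pos
    omega
  simp [this]

theorem exists_zero_sum_of_card_eq {q : ℕ} (hq : q.Prime) (M : Multiset (ZMod q))
    (hM : card M = q) : ∃ T ≤ M, T ≠ 0 ∧ T.sum = 0 := by
  by_cases h0 : 0 ∈ M
  · exact ⟨{0}, by simpa using h0, by simp, by simp⟩
  obtain ⟨a, ha⟩ := card_pos_iff_exists_mem.1 (hM ▸ hq.pos)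
  obtain ⟨M, rfl⟩ := exists_cons_of_mem ha
  rw [card_cons] at hM
  obtain ⟨T, hT, hs⟩ := exists_le_sum_eq_of_card hq M (fun h => h0 (mem_cons_of_mem h))
    (by omega) (-a)
  exact ⟨a ::ₘ T, cons_le_cons _ hT, cons_ne_zero, by rw [sum_cons, hs, add_neg_cancel]⟩

/-- `HasGain S w n` says that the subsequence sums of `S` with first coordinate `w` contain a
translate of the subsequence sums of some sequence of `n` nonzero elements. -/
def HasGain {A B : Type*} [AddCommGroup A] [AddCommGroup B] (S : Multiset (A × B)) (w : A)
    (n : ℕ) : Prop :=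
  ∃ (t : B) (M : Multiset B), card M = n ∧ 0 ∉ M ∧
    ∀ M' ≤ M, ∃ T ≤ S, T.sum = (w, t + M'.sum)

section HasGain

variable {A B : Type*} [AddCommGroup A] [AddCommGroup B]

theorem HasGain.add {S₁ S₂ : Multiset (A × B)} {w₁ w₂ : A} {n₁ n₂ : ℕ} (h₁ : HasGain S₁ w₁ n₁)
    (h₂ : HasGain S₂ w₂ n₂) : HasGain (S₁ + S₂) (w₁ + w₂) (n₁ + n₂) := by
  obtain ⟨t₁, M₁, hc₁, hz₁, hM₁⟩ := h₁
  obtain ⟨t₂, M₂, hc₂, hz₂, hM₂⟩ := h₂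
  refine ⟨t₁ + t₂, M₁ + M₂, by rw [card_add, hc₁, hc₂], by simp [hz₁, hz₂], fun M' hM' => ?_⟩
  obtain ⟨U, hU, V, hV, rfl⟩ := exists_add_eq_of_le_add hM'
  obtain ⟨T₁, hT₁, hs₁⟩ := hM₁ U hU
  obtain ⟨T₂, hT₂, hs₂⟩ := hM₂ V hV
  refine ⟨T₁ + T₂, add_le_add hT₁ hT₂, ?_⟩
  rw [sum_add, hs₁, hs₂, sum_add, Prod.mk_add_mk]
  congr 1
  abel

theorem hasGain_zero_of_le {S T : Multiset (A × B)} (h : T ≤ S) : HasGain S T.sum.1 0 :=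
  ⟨T.sum.2, 0, rfl, by simp, fun M' hM' => ⟨T, h, by simp [Multiset.le_zero.1 hM']⟩⟩

theorem hasGain_one_of_le {S T U : Multiset (A × B)} (hT : T ≤ S) (hU : U ≤ S)
    (h1 : T.sum.1 = U.sum.1) (h2 : T.sum.2 ≠ U.sum.2) : HasGain S T.sum.1 1 := by
  refine ⟨T.sum.2, {U.sum.2 - T.sum.2}, rfl, ?_, fun M' hM' => ?_⟩
  · rw [mem_singleton]
    exact fun h => h2 (sub_eq_zero.1 h.symm).symm
  · rcases le_singleton.1 hM' with rfl | rfl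
    · exact ⟨T, hT, by simp⟩
    · exact ⟨U, hU, by ext <;> simp [h1]⟩

theorem sum_map_mk (v : A) (Z : Multiset B) :
    (Z.map fun z => (v, z)).sum = (card Z • v, Z.sum) := by
  induction Z using Multiset.induction_on with
  | empty => simp [Prod.ext_iff]
  | cons a Z ih => rw [map_cons, sum_cons, ih, sum_cons, card_cons, Prod.mk_add_mk, succ_nsmul']

theorem hasGain_map_zero (Z : Multiset B) (h : 0 ∉ Z) :
    HasGain (Z.map fun z => ((0 : A), z)) 0 (card Z) := by
  refine ⟨0, Z, rfl, h, fun M' hM' => ⟨M'.map fun z => ((0 : A), z), map_le_map hM', ?_⟩⟩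
  rw [sum_map_mk, smul_zero, zero_add]

end HasGain

/-- For each shape `τ` of a sequence of `N` elements over a line of `C₃ ⊕ C₃` and each residue
`c` of the number of elements chosen, `(N - lineLoss τ c) / 3` elements are gained; the value `9`
marks infeasible residues. -/
def lineLoss (τ : Fin 6) (c : Fin 3) : ℕ :=
  (![![0, 9, 9], ![1, 1, 9], ![1, 1, 4], ![2, 2, 2], ![0, 3, 3], ![3, 0, 0]] :
    Fin 6 → Fin 3 → ℕ) τ c

theorem exists_lineLoss_le : ∀ τ₁ τ₂ τ₃ τ₄ : Fin 6,
    2 ≤ (if 2 ≤ τ₁ then 1 else 0) + (if 2 ≤ τ₂ then 1 else 0) + (if 2 ≤ τ₃ then 1 else 0) +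
      (if 2 ≤ τ₄ then 1 else 0) →
    ∀ w₁ w₂ : Fin 3, ∃ c₃ c₄ : Fin 3,
      lineLoss τ₁ (w₁ - c₃ - c₄) + lineLoss τ₂ (w₂ - c₃ + c₄) + lineLoss τ₃ c₃ +
        lineLoss τ₄ c₄ ≤ 8 := by
  decide +kernel

theorem exists_sum_smul_eq : ∀ w : ZMod 3 × ZMod 3, ∃ w₁ w₂ : Fin 3, ∀ c₃ c₄ : Fin 3,
    (w₁ - c₃ - c₄).val • ((1, 0) : ZMod 3 × ZMod 3) +
      (w₂ - c₃ + c₄).val • ((0, 1) : ZMod 3 × ZMod 3) +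
      c₃.val • ((1, 1) : ZMod 3 × ZMod 3) + c₄.val • ((1, 2) : ZMod 3 × ZMod 3) = w := by
  decide +kernel

section Line

variable {A B : Type*} [AddCommGroup A] [AddCommGroup B]

theorem exists_triple [DecidableEq B] (h3 : ∀ z : B, 3 • z = 0 → z = 0) (Z : Multiset B)
    (hZ : 4 ≤ card Z) (h0 : Z.count 0 ≤ 2) : ∃ T ≤ Z, card T = 3 ∧ T.sum ≠ 0 := by
  by_contra! H
  obtain ⟨U, hU, hc⟩ := exists_le_card_eq Z hZ
  obtain ⟨a, ha⟩ := card_pos_iff_exists_mem.1 (show 0 < card U by omega)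
  obtain ⟨U, rfl⟩ := exists_cons_of_mem ha
  rw [card_cons, show card U + 1 = 4 ↔ card U = 3 by omega, card_eq_three] at hc
  obtain ⟨b, c, d, rfl⟩ := hc
  have e1 := H {b, c, d} ((le_cons_self _ _).trans hU) rfl
  have e2 := H {a, c, d} ((cons_le_cons a (le_cons_self _ _)).trans hU) rfl
  have e3 := H {a, b, d} ((cons_le_cons a (cons_le_cons b (le_cons_self _ _))).trans hU) rfl
  have e4 := H {a, b, c} ((cons_le_cons a (cons_le_cons b (cons_le_cons c
    (Multiset.zero_le _)))).trans hU) rfl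
  simp only [insert_eq_cons, sum_cons, sum_singleton] at e1 e2 e3 e4
  have hab : a = b := add_right_cancel (e2.trans e1.symm)
  subst hab
  have hac : c = a := add_right_cancel (add_left_cancel (e2.trans e3.symm))
  subst hac
  have hcd : d = c := add_left_cancel (add_left_cancel (e3.trans e4.symm))
  subst hcd
  have hd : d = 0 := h3 d (by rw [← e4]; abel)
  subst hd
  have := count_le_of_le 0 hU
  simp at this
  omega

theorem HasGain.of_triple [DecidableEq B] {Z T : Multiset B} {v w : A} {n : ℕ}
    (hv : 3 • v = 0) (hT : T ≤ Z) (hc : card T = 3) (hs : T.sum ≠ 0)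
    (h : HasGain ((Z - T).map fun z => (v, z)) w n) :
    HasGain (Z.map fun z => (v, z)) w (n + 1) := by
  have h1 : HasGain (T.map fun z => (v, z)) ((0 : Multiset (A × B)).sum.1) 1 := by
    refine hasGain_one_of_le (U := T.map fun z => (v, z)) (Multiset.zero_le _) le_rfl ?_ ?_
    · rw [sum_map_mk, hc, hv, sum_zero, Prod.fst_zero]
    · rw [sum_map_mk, sum_zero, Prod.snd_zero]
      exact hs.symm
  have h2 := h.add h1
  rwa [sum_zero, Prod.fst_zero, add_zero, ← Multiset.map_add, tsub_add_cancel_of_le hT] at h2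

theorem hasGain_line_zero (Z : Multiset B) (v : A) {c : ℕ} (hc : c ≤ card Z) :
    HasGain (Z.map fun z => (v, z)) (c • v) 0 := by
  obtain ⟨T, hT, rfl⟩ := exists_le_card_eq Z hc
  have := hasGain_zero_of_le (map_le_map (f := fun z => (v, z)) hT)
  rwa [sum_map_mk] at this

theorem hasGain_line_one {Z T U : Multiset B} (v : A) (hT : T ≤ Z) (hU : U ≤ Z)
    (h1 : card T = card U) (h2 : T.sum ≠ U.sum) :
    HasGain (Z.map fun z => (v, z)) (card T • v) 1 := by
  have := hasGain_one_of_le (map_le_map (f := fun z => (v, z)) hT)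
    (map_le_map (f := fun z => (v, z)) hU) (by simp only [sum_map_mk, h1])
    (by simpa only [sum_map_mk] using h2)
  rwa [sum_map_mk] at this

theorem exists_lineLoss_of_card_eq_three [DecidableEq B] (h3 : ∀ z : B, 3 • z = 0 → z = 0)
    {v : A} (hv : 3 • v = 0) (Z : Multiset B) (hZ : card Z = 3) (h0 : Z.count 0 ≤ 2) :
    ∃ τ : Fin 6, 2 ≤ τ ∧ ∀ c : Fin 3, ∃ n, 3 ≤ 3 * n + lineLoss τ c ∧
      HasGain (Z.map fun z => (v, z)) (c.val • v) n := by
  by_cases hs : Z.sum = 0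
  · obtain ⟨x, y, w, rfl⟩ := card_eq_three.1 hZ
    have key : ∃ a b c, ({a, b, c} : Multiset B) = {x, y, w} ∧ a ≠ b := by
      by_cases hxy : x = y
      · subst hxy
        refine ⟨x, w, x, ?_, fun h => ?_⟩
        · simp only [insert_eq_cons]
          congr 1
          exact cons_swap _ _ 0
        · subst h
          have hx : x = 0 := by
            apply h3
            rw [← hs]
            simp only [insert_eq_cons, sum_cons, sum_singleton]
            abel
          subst hx
          simp at h0
      · exact ⟨x, y, w, rfl, hxy⟩
    obtain ⟨a, b, d, he, hab⟩ := key
    rw [← he]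
    have ha : ({a} : Multiset B) ≤ {a, b, d} := cons_le_cons a (Multiset.zero_le _)
    have hb : ({b} : Multiset B) ≤ {a, b, d} := by simp
    have hbd : ({b, d} : Multiset B) ≤ {a, b, d} := le_cons_self _ _
    have had : ({a, d} : Multiset B) ≤ {a, b, d} := cons_le_cons a (le_cons_self _ _)
    refine ⟨5, by decide, fun c => ?_⟩
    fin_cases c
    · exact ⟨0, by decide, hasGain_line_zero _ v (Nat.zero_le _)⟩
    · exact ⟨1, by decide, hasGain_line_one v ha hb rfl (by simpa using hab)⟩
    · exact ⟨1, by decide, hasGain_line_one v had hbd rfl (by simpa using hab)⟩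
  · refine ⟨4, by decide, fun c => ?_⟩
    by_cases hc : c = 0
    · subst hc
      exact ⟨1, by decide, HasGain.of_triple hv le_rfl hZ hs
        (hasGain_line_zero _ v (Nat.zero_le _))⟩
    · have H : ∀ c, c ≠ 0 → 3 ≤ 3 * 0 + lineLoss 4 c := by decide
      exact ⟨0, H c hc, hasGain_line_zero _ v (by omega)⟩

theorem exists_lineLoss [DecidableEq B] (h3 : ∀ z : B, 3 • z = 0 → z = 0) {v : A}
    (hv : 3 • v = 0) (Z : Multiset B) (h0 : Z.count 0 ≤ 2) :
    ∃ τ : Fin 6, (2 ≤ card Z → 2 ≤ τ) ∧ ∀ c : Fin 3, lineLoss τ c ≤ 8 →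
      ∃ n, card Z ≤ 3 * n + lineLoss τ c ∧ HasGain (Z.map fun z => (v, z)) (c.val • v) n := by
  induction hN : card Z using Nat.strong_induction_on generalizing Z with
  | _ N ih =>
  subst hN
  have base (c : Fin 3) (τ : Fin 6) (h1 : c.val ≤ card Z) (h2 : card Z ≤ lineLoss τ c) :
      ∃ n, card Z ≤ 3 * n + lineLoss τ c ∧ HasGain (Z.map fun z => (v, z)) (c.val • v) n :=
    ⟨0, by omega, hasGain_line_zero Z v h1⟩
  rcases Nat.lt_or_ge (card Z) 4 with hlt | hge
  · have hcases : card Z = 0 ∨ card Z = 1 ∨ card Z = 2 ∨ card Z = 3 := by omega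
    rcases hcases with h | h | h | h
    · have H : ∀ c, lineLoss 0 c ≤ 8 → c.val ≤ 0 ∧ 0 ≤ lineLoss 0 c := by decide
      exact ⟨0, by omega, fun c hc => base c 0 (h ▸ (H c hc).1) (h ▸ (H c hc).2)⟩
    · have H : ∀ c, lineLoss 1 c ≤ 8 → c.val ≤ 1 ∧ 1 ≤ lineLoss 1 c := by decide
      exact ⟨1, by omega, fun c hc => base c 1 (h ▸ (H c hc).1) (h ▸ (H c hc).2)⟩
    · have H : ∀ c, lineLoss 3 c ≤ 8 → c.val ≤ 2 ∧ 2 ≤ lineLoss 3 c := by decide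
      exact ⟨3, fun _ => by decide, fun c hc => base c 3 (h ▸ (H c hc).1) (h ▸ (H c hc).2)⟩
    · obtain ⟨τ, h2, hτ⟩ := exists_lineLoss_of_card_eq_three h3 hv Z h h0
      exact ⟨τ, fun _ => h2, fun c _ => by rw [h]; exact hτ c⟩
  · obtain ⟨T, hT, hc, hs⟩ := exists_triple h3 Z hge h0
    have hcard : card (Z - T) = card Z - 3 := by rw [card_sub hT, hc]
    obtain ⟨τ, h2, hτ⟩ := ih (card (Z - T)) (by omega) (Z - T)
      ((count_le_of_le 0 (Multiset.sub_le_self Z T)).trans h0) rfl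
    by_cases h4 : card Z = 4
    · refine ⟨2, fun _ => le_rfl, fun c _ => ?_⟩
      by_cases hc2 : c = 2
      · subst hc2
        exact base 2 2 (by rw [h4]; decide) (by rw [h4]; decide)
      · have H : ∀ c, c ≠ 2 → c.val ≤ 1 ∧ 4 ≤ 3 * (0 + 1) + lineLoss 2 c := by decide
        refine ⟨0 + 1, h4 ▸ (H c hc2).2, HasGain.of_triple hv hT hc hs (hasGain_line_zero _ v ?_)⟩
        rw [hcard, h4]
        exact (H c hc2).1
    · refine ⟨τ, fun _ => h2 (by omega), fun c hcτ => ?_⟩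
      obtain ⟨n, hn, hg⟩ := hτ c hcτ
      exact ⟨n + 1, by omega, hg.of_triple hv hT hc hs⟩

end Line

section Flip

variable {G : Type*} [AddCommGroup G]

/-- Replacing some terms of a sequence by their negatives translates its set of subsequence
sums. -/
theorem exists_translate_of_flip {φ : G → G} (hφ : ∀ x, φ x = x ∨ φ x = -x) (S : Multiset G) :
    ∃ t : G, ∀ T ≤ S.map φ, ∃ U ≤ S, U.sum = T.sum + t := by
  classical
  induction S using Multiset.induction_on with
  | empty => exact ⟨0, fun T hT => ⟨0, le_rfl, by simp_all⟩⟩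
  | cons a S ih =>
    obtain ⟨t, ht⟩ := ih
    have hsplit : ∀ T ≤ (a ::ₘ S).map φ, ∃ V ≤ S.map φ, T = V ∨ T = φ a ::ₘ V := by
      intro T hT
      rw [map_cons] at hT
      by_cases ha : φ a ∈ T
      · obtain ⟨V, rfl⟩ := exists_cons_of_mem ha
        exact ⟨V, (cons_le_cons_iff _).1 hT, Or.inr rfl⟩
      · exact ⟨T, (le_cons_of_notMem ha).1 hT, Or.inl rfl⟩
    rcases hφ a with h | h
    · refine ⟨t, fun T hT => ?_⟩
      obtain ⟨V, hV, e | e⟩ := hsplit T hT <;> obtain ⟨U, hU, hs⟩ := ht V hV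
      · exact ⟨U, hU.trans (le_cons_self _ _), e ▸ hs⟩
      · exact ⟨a ::ₘ U, cons_le_cons _ hU, by rw [e, sum_cons, sum_cons, hs, h, add_assoc]⟩
    · refine ⟨t + a, fun T hT => ?_⟩
      obtain ⟨V, hV, e | e⟩ := hsplit T hT <;> obtain ⟨U, hU, hs⟩ := ht V hV
      · exact ⟨a ::ₘ U, cons_le_cons _ hU, by rw [e, sum_cons, hs]; abel⟩
      · exact ⟨U, hU.trans (le_cons_self _ _), by rw [e, sum_cons, hs, h]; abel⟩

end Flip

section Fibers

variable {A B : Type*} [DecidableEq A]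

/-- The second coordinates of the terms of `S` with first coordinate `v`. -/
def fiber (S : Multiset (A × B)) (v : A) : Multiset B :=
  (S.filter fun x => x.1 = v).map Prod.snd

theorem map_fiber (S : Multiset (A × B)) (v : A) :
    ((fiber S v).map fun z => (v, z)) = S.filter fun x => x.1 = v := by
  rw [fiber, map_map]
  conv_rhs => rw [← map_id (S.filter fun x => x.1 = v)]
  refine map_congr rfl fun x hx => ?_
  rw [← (mem_filter.1 hx).2]
  rfl

theorem card_fiber (S : Multiset (A × B)) (v : A) :
    card (fiber S v) = card (S.filter fun x => x.1 = v) :=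
  card_map _ _

theorem count_fiber [DecidableEq B] (S : Multiset (A × B)) (v : A) (z : B) :
    (fiber S v).count z = S.count (v, z) := by
  rw [← count_map_eq_count' _ _ (Prod.mk_right_injective v) z, map_fiber,
    count_filter_of_pos (p := fun x : A × B => x.1 = v) rfl]

end Fibers

theorem smul_eq_zero_of_three {q : ℕ} (hq : q.Prime) (hq5 : 5 ≤ q) (z : ZMod q)
    (h : 3 • z = 0) : z = 0 := by
  have := Fact.mk hq
  rw [nsmul_eq_mul] at h
  refine (mul_eq_zero.1 h).resolve_left fun h3 => ?_
  rw [ZMod.natCast_eq_zero_iff] at h3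
  have := Nat.le_of_dvd (by norm_num) h3
  omega

theorem three_smul_eq_zero (v : ZMod 3 × ZMod 3) : 3 • v = 0 := by
  revert v
  decide

/-- One generator for each subgroup of order three of `C₃ ⊕ C₃`. -/
def lineGens : Finset (ZMod 3 × ZMod 3) := {(1, 0), (0, 1), (1, 1), (1, 2)}

theorem sum_eq_of_lines {q : ℕ} (hq : q.Prime) (hq5 : 5 ≤ q)
    (S : Multiset ((ZMod 3 × ZMod 3) × ZMod q)) (h0 : 0 ∉ S)
    (hS : ∀ x ∈ S, x.1 = 0 ∨ x.1 ∈ lineGens) (h2 : ∀ v ∈ lineGens, S.count (v, 0) ≤ 2)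
    (hH : ∀ v ∈ lineGens, card (fiber S 0) + card (fiber S v) ≤ 3 * q - 1)
    (hc : 3 * q + 3 ≤ card S) (g : (ZMod 3 × ZMod 3) × ZMod q) : ∃ T ≤ S, T.sum = g := by
  have hdecomp : S = (S.filter fun x => x.1 = 0) + (((S.filter fun x => x.1 = (1, 0)) +
      (S.filter fun x => x.1 = (0, 1)) + (S.filter fun x => x.1 = (1, 1))) +
      (S.filter fun x => x.1 = (1, 2))) := by
    ext x
    by_cases hx : x ∈ S
    · have hx' := hS x hx
      simp only [lineGens, Finset.mem_insert, Finset.mem_singleton] at hx'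
      simp only [count_add, count_filter]
      rcases hx' with h | h | h | h | h <;> rw [h] <;> simp +decide
    · simp only [count_add, count_filter, count_eq_zero_of_notMem hx, ite_self, add_zero]
  have hcard := congrArg card hdecomp
  simp only [card_add, ← card_fiber] at hcard
  have hg₁ : ((1, 0) : ZMod 3 × ZMod 3) ∈ lineGens := by decide
  have hg₂ : ((0, 1) : ZMod 3 × ZMod 3) ∈ lineGens := by decide
  have hg₃ : ((1, 1) : ZMod 3 × ZMod 3) ∈ lineGens := by decide
  have hg₄ : ((1, 2) : ZMod 3 × ZMod 3) ∈ lineGens := by decide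
  have line (v) (hv : v ∈ lineGens) :=
    exists_lineLoss (smul_eq_zero_of_three hq hq5) (three_smul_eq_zero v) (fiber S v)
      (by rw [count_fiber]; exact h2 v hv)
  obtain ⟨τ₁, hb₁, hl₁⟩ := line _ hg₁
  obtain ⟨τ₂, hb₂, hl₂⟩ := line _ hg₂
  obtain ⟨τ₃, hb₃, hl₃⟩ := line _ hg₃
  obtain ⟨τ₄, hb₄, hl₄⟩ := line _ hg₄
  have hH₁ := hH _ hg₁
  have hH₂ := hH _ hg₂
  have hH₃ := hH _ hg₃
  have hH₄ := hH _ hg₄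
  obtain ⟨w₁, w₂, hw⟩ := exists_sum_smul_eq g.1
  obtain ⟨c₃, c₄, hloss⟩ := exists_lineLoss_le τ₁ τ₂ τ₃ τ₄ (by split_ifs <;> omega) w₁ w₂
  obtain ⟨n₁, hn₁, hG₁⟩ := hl₁ (w₁ - c₃ - c₄) (by omega)
  obtain ⟨n₂, hn₂, hG₂⟩ := hl₂ (w₂ - c₃ + c₄) (by omega)
  obtain ⟨n₃, hn₃, hG₃⟩ := hl₃ c₃ (by omega)
  obtain ⟨n₄, hn₄, hG₄⟩ := hl₄ c₄ (by omega)
  have hG₀ := hasGain_map_zero (A := ZMod 3 × ZMod 3) (fiber S 0)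
    (by rwa [← count_eq_zero, count_fiber, count_eq_zero])
  have hG := hG₀.add (((hG₁.add hG₂).add hG₃).add hG₄)
  simp only [map_fiber] at hG
  rw [← hdecomp, hw, zero_add] at hG
  obtain ⟨t, M, hMc, hM0, hM⟩ := hG
  obtain ⟨M', hM', hs⟩ := exists_le_sum_eq_of_card hq M hM0 (by omega) (g.2 - t)
  obtain ⟨T, hT, hTs⟩ := hM M' hM'
  exact ⟨T, hT, by rw [hTs, hs, add_sub_cancel]⟩

section Regular

variable {q : ℕ}

theorem card_prod_addSubgroup {A B : Type*} [AddCommGroup A] [AddCommGroup B]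
    (H : AddSubgroup A) (K : AddSubgroup B) :
    Nat.card (H.prod K) = Nat.card H * Nat.card K := by
  rw [← Nat.card_prod]
  exact Nat.card_congr (AddSubgroup.prodEquiv H K).toEquiv

theorem card_zmultiples_lineGen {v : ZMod 3 × ZMod 3} (hv : v ∈ lineGens) :
    Nat.card (AddSubgroup.zmultiples v) = 3 := by
  rw [Nat.card_zmultiples]
  refine addOrderOf_eq_prime (three_smul_eq_zero v) ?_
  revert v
  decide

theorem zmultiples_lineGen_ne_top {v : ZMod 3 × ZMod 3} (hv : v ∈ lineGens) :
    AddSubgroup.zmultiples v ≠ ⊤ := by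
  intro h
  have h1 := card_zmultiples_lineGen hv
  rw [h, AddSubgroup.card_top, Nat.card_prod, Nat.card_zmod] at h1
  omega

open scoped Classical in
theorem IsRegularSeq.card_filter_prod_le {S : Multiset ((ZMod 3 × ZMod 3) × ZMod q)}
    (hS : IsRegularSeq S) {v : ZMod 3 × ZMod 3} (hv : v ∈ lineGens) (K : AddSubgroup (ZMod q)) :
    card (S.filter fun x => x ∈ (AddSubgroup.zmultiples v).prod K) ≤ 3 * Nat.card K - 1 := by
  have h := hS ((AddSubgroup.zmultiples v).prod K) fun h => ?_
  · rwa [card_prod_addSubgroup, card_zmultiples_lineGen hv] at h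
  · apply zmultiples_lineGen_ne_top hv
    rw [eq_top_iff]
    intro w _
    have : ((w, 0) : (ZMod 3 × ZMod 3) × ZMod q) ∈ (AddSubgroup.zmultiples v).prod K := by
      rw [h]
      trivial
    exact (AddSubgroup.mem_prod.1 this).1

theorem IsRegularSeq.zero_notMem {G : Type*} [AddCommGroup G] [Nontrivial G] {S : Multiset G}
    (hS : IsRegularSeq S) : 0 ∉ S := by
  classical
  intro h
  have h1 := hS ⊥ bot_ne_top
  rw [AddSubgroup.card_bot, Nat.sub_self, Nat.le_zero, card_eq_zero, filter_eq_nil] at h1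
  exact h1 0 h (AddSubgroup.zero_mem _)

theorem IsRegularSeq.exists_sum_eq (hq : q.Prime) (hq5 : 5 ≤ q)
    {S : Multiset ((ZMod 3 × ZMod 3) × ZMod q)} (hS : IsRegularSeq S)
    (hc : 3 * q + 3 ≤ card S) (g : (ZMod 3 × ZMod 3) × ZMod q) : ∃ T ≤ S, T.sum = g := by
  classical
  have := Fact.mk hq
  let φ : (ZMod 3 × ZMod 3) × ZMod q → (ZMod 3 × ZMod 3) × ZMod q :=
    fun x => if x.1 = 0 ∨ x.1 ∈ lineGens then x else -x
  have hφ (x) : φ x = x ∨ φ x = -x := by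
    simp only [φ]
    split_ifs <;> simp
  have hmem (H : AddSubgroup ((ZMod 3 × ZMod 3) × ZMod q)) (x) (h : φ x ∈ H) : x ∈ H := by
    rcases hφ x with hx | hx <;> rw [hx] at h
    · exact h
    · exact neg_mem_iff.1 h
  have hgens : ∀ k : ZMod 3 × ZMod 3, (k = 0 ∨ k ∈ lineGens) ∨ (-k = 0 ∨ -k ∈ lineGens) := by
    decide
  obtain ⟨t, ht⟩ := exists_translate_of_flip hφ S
  suffices h : ∃ T ≤ S.map φ, T.sum = g - t by
    obtain ⟨T, hT, hs⟩ := h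
    obtain ⟨U, hU, hUs⟩ := ht T hT
    exact ⟨U, hU, by rw [hUs, hs, sub_add_cancel]⟩
  refine sum_eq_of_lines hq hq5 (S.map φ) ?_ ?_ ?_ ?_ (by rwa [card_map]) (g - t)
  · intro h
    obtain ⟨x, hx, hx0⟩ := mem_map.1 h
    have := hmem ⊥ x (by rw [hx0]; exact zero_mem _)
    rw [AddSubgroup.mem_bot] at this
    exact hS.zero_notMem (this ▸ hx)
  · intro y hy
    obtain ⟨x, hx, rfl⟩ := mem_map.1 hy
    simp only [φ]
    split_ifs with h
    · exact h
    · exact (hgens x.1).resolve_left h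
  · intro v hv
    have h := hS.card_filter_prod_le hv ⊥
    rw [AddSubgroup.card_bot] at h
    refine le_trans ?_ h
    rw [count_map]
    refine card_le_card (monotone_filter_right S fun x hx => hmem _ x ?_)
    rw [← hx]
    exact ⟨AddSubgroup.mem_zmultiples v, zero_mem _⟩
  · intro v hv
    have h := hS.card_filter_prod_le hv ⊤
    rw [AddSubgroup.card_top, Nat.card_zmod] at h
    refine le_trans ?_ h
    have hv0 : v ≠ 0 := fun h0 => absurd (h0 ▸ hv) (by decide)
    have hdisj : ((S.map φ).filter fun x => x.1 = 0 ∧ x.1 = v) = 0 :=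
      filter_eq_nil.2 fun x _ hx => hv0 (hx.2.symm.trans hx.1)
    rw [card_fiber, card_fiber, ← card_add, filter_add_filter, card_add, hdisj, card_zero,
      add_zero, filter_map, card_map]
    refine card_le_card (monotone_filter_right S fun x hx => hmem _ x ?_)
    refine ⟨?_, trivial⟩
    rcases hx with hx | hx
    · exact (show (φ x).1 = 0 from hx) ▸ zero_mem _
    · exact (show (φ x).1 = v from hx) ▸ AddSubgroup.mem_zmultiples v

end Regular

section ZeroSum

theorem card_le_three_of_no_short_zero_sum : ∀ F : Finset (ZMod 3 × ZMod 3),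
    (0 ∉ F ∧ (∀ x ∈ F, -x ∉ F) ∧
      ∀ x ∈ F, ∀ y ∈ F, x ≠ y → -(x + y) ∉ F ∨ -(x + y) = x ∨ -(x + y) = y) →
    F.card ≤ 3 ∧ (F.card = 3 → ∃ x ∈ F, 2 • ∑ y ∈ F, y = x) := by
  set_option synthInstance.maxHeartbeats 200000 in
  set_option synthInstance.maxSize 1000 in
  decide +kernel

/-- Every sequence of at least six elements of `C₃ ⊕ C₃` has a nonempty zero-sum subsequence,
which can be chosen of length at most three if there are at least seven elements. -/
theorem exists_short_zero_sum (S : Multiset (ZMod 3 × ZMod 3)) (hS : 6 ≤ card S) :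
    ∃ T ≤ S, T ≠ 0 ∧ T.sum = 0 ∧ (card T ≤ 3 ∨ card S = 6) := by
  by_contra! H
  have H' (T) (hT : T ≤ S) (h0 : T ≠ 0) (hc : card T ≤ 3) : T.sum ≠ 0 := fun h =>
    (H T hT h0 h).1.not_ge hc
  have hcount (x) : S.count x ≤ 2 := by
    by_contra! h
    refine H' (replicate 3 x) (le_count_iff_replicate_le.1 h) ?_ (by simp) ?_
    · rw [← card_pos, card_replicate]
      norm_num
    · rw [sum_replicate]
      exact three_smul_eq_zero x
  have hnodup (T : Multiset (ZMod 3 × ZMod 3)) (hT : T.Nodup) (hTS : ∀ x ∈ T, x ∈ S) : T ≤ S :=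
    (le_iff_subset hT).2 hTS
  have hneg (x : ZMod 3 × ZMod 3) : x ≠ 0 → x ≠ -x := by
    revert x
    decide
  have h0 : 0 ∉ S := fun h => H' {0} (by simpa using h) (by simp) (by simp) (by simp)
  obtain ⟨hF, hF3⟩ := card_le_three_of_no_short_zero_sum S.toFinset (by
    simp only [mem_toFinset]
    refine ⟨h0, fun x hx hx' => ?_, fun x hx y hy hxy => ?_⟩
    · refine H' {x, -x} (hnodup _ ?_ ?_) (by simp) (by simp) (by simp)
      · simpa using hneg x (fun h => h0 (h ▸ hx))
      · simp [hx, hx']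
    · by_contra! h
      refine H' {x, y, -(x + y)} (hnodup _ ?_ ?_) (by simp) (by simp) ?_
      · simp only [insert_eq_cons, nodup_cons, mem_cons, mem_singleton, nodup_singleton, not_or]
        exact ⟨⟨hxy, h.2.1.symm⟩, h.2.2.symm, trivial⟩
      · simp only [insert_eq_cons, mem_cons, mem_singleton]
        rintro z (rfl | rfl | rfl)
        exacts [hx, hy, h.1]
      · simp only [insert_eq_cons, sum_cons, sum_singleton]
        abel)
  have hle : S ≤ 2 • S.toFinset.val := by
    rw [le_iff_count]
    intro x
    by_cases hx : x ∈ S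
    · rw [count_nsmul, count_eq_one_of_mem S.toFinset.nodup (by simpa using hx)]
      exact hcount x
    · rw [count_eq_zero_of_notMem hx]
      exact Nat.zero_le _
  have hcard : card (2 • S.toFinset.val) = 2 * S.toFinset.card := by
    rw [card_nsmul, Finset.card_val]
  have hc6 := card_le_card hle
  have heq : S = 2 • S.toFinset.val := eq_of_le_of_card_le hle (by omega)
  obtain ⟨x, hx, hsum⟩ := hF3 (by omega)
  rw [mem_toFinset] at hx
  have hsum' : S.sum = x := by
    rw [← hsum]
    conv_lhs => rw [heq]
    rw [sum_nsmul]
    simp [Finset.sum]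
  have hers : x + (S.erase x).sum = S.sum := by rw [← sum_cons, cons_erase hx]
  have hce : card (S.erase x) + 1 = card S := card_erase_add_one hx
  refine (H (S.erase x) (erase_le x S) ?_ ?_).2 (by omega)
  · rw [← card_pos]
    omega
  · rw [hsum'] at hers
    exact left_eq_add.1 hers.symm

theorem exists_short_zero_sum_fst {B : Type*} [AddCommGroup B]
    (S : Multiset ((ZMod 3 × ZMod 3) × B)) (hS : 6 ≤ card S) :
    ∃ T ≤ S, T ≠ 0 ∧ T.sum.1 = 0 ∧ (card T ≤ 3 ∨ card S = 6) := by
  obtain ⟨T₀, hT₀, hne, hs, hc⟩ := exists_short_zero_sum (S.map Prod.fst) (by rwa [card_map])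
  obtain ⟨T, hT, rfl⟩ := exists_map_eq_of_le_map hT₀
  rw [card_map, card_map] at hc
  refine ⟨T, hT, fun h => hne (by rw [h, map_zero]), ?_, hc⟩
  rw [← hs]
  exact map_multiset_sum (AddMonoidHom.fst _ _) T

theorem exists_zero_sum_blocks {B : Type*} [AddCommGroup B] (j : ℕ)
    (S : Multiset ((ZMod 3 × ZMod 3) × B)) (hS : 3 * (j + 1) + 3 ≤ card S) :
    ∃ M : Multiset B, card M = j + 1 ∧ ∀ M' ≤ M, M' ≠ 0 →
      ∃ T ≤ S, T ≠ 0 ∧ T.sum = (0, M'.sum) := by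
  classical
  induction j generalizing S with
  | zero =>
    obtain ⟨T, hT, hT0, hs, -⟩ := exists_short_zero_sum_fst S (by omega)
    refine ⟨{T.sum.2}, rfl, fun M' hM' h => ⟨T, hT, hT0, ?_⟩⟩
    rw [(le_singleton.1 hM').resolve_left h, sum_singleton, ← hs]
  | succ j ih =>
    obtain ⟨T, hT, hT0, hs, hc⟩ := exists_short_zero_sum_fst S (by omega)
    obtain ⟨M, hMc, hM⟩ := ih (S - T) (by rw [card_sub hT]; omega)
    refine ⟨{T.sum.2} + M, by rw [card_add, hMc, card_singleton, add_comm], fun M' hM' h => ?_⟩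
    obtain ⟨U, hU, V, hV, rfl⟩ := exists_add_eq_of_le_add hM'
    have hV' : ∃ W ≤ S - T, (V ≠ 0 → W ≠ 0) ∧ W.sum = (0, V.sum) := by
      by_cases hV0 : V = 0
      · exact ⟨0, Multiset.zero_le _, fun h => absurd hV0 h, by rw [hV0]; rfl⟩
      · obtain ⟨W, hW, hW0, hWs⟩ := hM V hV hV0
        exact ⟨W, hW, fun _ => hW0, hWs⟩
    obtain ⟨W, hW, hW0, hWs⟩ := hV'
    rcases le_singleton.1 hU with rfl | rfl
    · rw [zero_add] at h ⊢
      exact ⟨W, hW.trans (Multiset.sub_le_self _ _), hW0 h, hWs⟩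
    · refine ⟨T + W, ?_, fun h => hT0 (add_eq_zero.1 h).1, ?_⟩
      · rw [← add_tsub_cancel_of_le hT]
        exact add_le_add le_rfl hW
      · rw [sum_add, hWs, sum_add, sum_singleton]
        ext1 <;> simp [hs]

theorem exists_zero_sum {q : ℕ} (hq : q.Prime) (S : Multiset ((ZMod 3 × ZMod 3) × ZMod q))
    (hS : 3 * q + 3 ≤ card S) : ∃ T ≤ S, T ≠ 0 ∧ T.sum = 0 := by
  have hq0 := hq.pos
  obtain ⟨M, hMc, hM⟩ := exists_zero_sum_blocks (q - 1) S (by omega)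
  obtain ⟨M', hM', hM0, hs⟩ := exists_zero_sum_of_card_eq hq M (by omega)
  obtain ⟨T, hT, hT0, hTs⟩ := hM M' hM' hM0
  exact ⟨T, hT, hT0, by rw [hTs, hs]; rfl⟩

end ZeroSum

theorem IsRegularSeq.subSums_eq_univ {q : ℕ} (hq : q.Prime) (hq5 : 5 ≤ q)
    {S : Multiset ((ZMod 3 × ZMod 3) × ZMod q)} (hS : IsRegularSeq S)
    (hc : 3 * q + 3 ≤ card S) : subSums S = Set.univ := by
  refine Set.eq_univ_of_forall fun g => ?_
  by_cases hg : g = 0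
  · rw [hg]
    exact exists_zero_sum hq S hc
  · obtain ⟨T, hT, hs⟩ := hS.exists_sum_eq hq hq5 hc g
    exact ⟨T, hT, fun h => hg (by rw [← hs, h, sum_zero]), hs⟩

section Transfer

variable {G G' : Type*} [AddCommGroup G] [AddCommGroup G']

theorem IsRegularSeq.map_equiv {S : Multiset G} (hS : IsRegularSeq S) (e : G ≃+ G') :
    IsRegularSeq (S.map e) := by
  classical
  intro H hH
  have h := hS (H.comap e.toAddMonoidHom) fun h => hH ?_
  · have hcard : Nat.card (H.comap e.toAddMonoidHom) = Nat.card H :=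
      Nat.card_congr (e.toEquiv.subtypeEquiv fun _ => Iff.rfl)
    rw [hcard] at h
    rw [filter_map, card_map]
    exact h
  · rw [eq_top_iff]
    intro x _
    have hx : e.symm x ∈ H.comap e.toAddMonoidHom := by
      rw [h]
      trivial
    have hx' : e (e.symm x) ∈ H := hx
    rwa [e.apply_symm_apply] at hx'

theorem subSums_eq_univ_of_map_equiv {S : Multiset G} (e : G ≃+ G')
    (h : subSums (S.map e) = Set.univ) : subSums S = Set.univ := by
  refine Set.eq_univ_of_forall fun g => ?_
  obtain ⟨T, hT, hT0, hs⟩ := (h ▸ Set.mem_univ (e g) : e g ∈ subSums (S.map e))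
  obtain ⟨U, hU, rfl⟩ := exists_map_eq_of_le_map hT
  refine ⟨U, hU, fun h => hT0 (by rw [h, map_zero]), e.injective ?_⟩
  rw [← hs, map_multiset_sum]

end Transfer

section LowerBound

variable (q : ℕ)

/-- A regular sequence of length `3q + 2` whose subsequence sums omit `(2, 1)`. -/
def extremalSeq : Multiset (ZMod 3 × ZMod (3 * q)) :=
  replicate (3 * q - 2) (0, 1) + replicate 4 (1, 1)

theorem notMem_subSums_extremalSeq (hq5 : 5 ≤ q) : (2, 1) ∉ subSums (extremalSeq q) := by
  rintro ⟨T, hT, -, hs⟩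
  obtain ⟨U, hU, V, hV, rfl⟩ := exists_add_eq_of_le_add hT
  obtain ⟨i, hi, rfl⟩ := le_replicate_iff.1 hU
  obtain ⟨j, hj, rfl⟩ := le_replicate_iff.1 hV
  simp only [sum_add, sum_replicate, Prod.smul_mk, smul_zero, Prod.mk_add_mk, zero_add,
    nsmul_eq_mul, mul_one, Prod.mk.injEq] at hs
  obtain ⟨h1, h2⟩ := hs
  have hj2 : j = 2 := by
    interval_cases j <;> first | rfl | exact absurd h1 (by decide)
  subst hj2
  have h3 : ((i + 1 : ℕ) : ZMod (3 * q)) = 0 := by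
    push_cast at h2 ⊢
    linear_combination h2
  rw [ZMod.natCast_eq_zero_iff] at h3
  have := Nat.le_of_dvd (Nat.succ_pos i) h3
  omega

theorem card_filter_replicate {α : Type*} (p : α → Prop) [DecidablePred p] (n : ℕ) (a : α) :
    card (filter p (replicate n a)) = if p a then n else 0 := by
  split_ifs with h
  · rw [filter_eq_self.2 fun b hb => (eq_of_mem_replicate hb) ▸ h, card_replicate]
  · rw [filter_eq_nil.2 fun b hb => (eq_of_mem_replicate hb) ▸ h, card_zero]

theorem isRegularSeq_extremalSeq (hq5 : 5 ≤ q) : IsRegularSeq (extremalSeq q) := by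
  classical
  intro H hH
  have : NeZero (3 * q) := ⟨by omega⟩
  have hdvd (a : ZMod 3) (ha : ((a, 1) : ZMod 3 × ZMod (3 * q)) ∈ H) :
      3 * q ≤ Nat.card H := by
    have h1 := H.addOrderOf_dvd_natCard ha
    rw [Prod.addOrderOf, ZMod.addOrderOf_one] at h1
    exact Nat.le_of_dvd Nat.card_pos ((Nat.dvd_lcm_right _ _).trans h1)
  have hnot : ¬ (((0, 1) : ZMod 3 × ZMod (3 * q)) ∈ H ∧
      ((1, 1) : ZMod 3 × ZMod (3 * q)) ∈ H) := by
    rintro ⟨h1, h2⟩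
    refine hH ((AddSubgroup.eq_top_iff' H).2 fun x => ?_)
    have hx : x = x.1.val • (((1, 1) : ZMod 3 × ZMod (3 * q)) - (0, 1)) +
        x.2.val • ((0, 1) : ZMod 3 × ZMod (3 * q)) := by
      ext <;> simp
    rw [hx]
    exact H.add_mem (H.nsmul_mem (H.sub_mem h2 h1) _) (H.nsmul_mem h1 _)
  rw [extremalSeq, filter_add, card_add, card_filter_replicate, card_filter_replicate]
  split_ifs with h1 h2 h2
  · exact absurd ⟨h1, h2⟩ hnot
  · have := hdvd _ h1
    omega
  · have := hdvd _ h2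
    omega
  · exact Nat.zero_le _

end LowerBound

/-- c₀(C₃ ⊕ C₃q) = 3q + 3 for a prime q ≥ 5: `3*q + 3` is the least `t` such that every
regular sequence over `(ℤ/3ℤ) × (ℤ/3qℤ)` of length at least `t` is an additive basis. -/
theorem c0_eq (q : ℕ) (hq : q.Prime) (hq5 : 5 ≤ q) :
    IsLeast {t : ℕ | ∀ S : Multiset (ZMod 3 × ZMod (3 * q)),
      IsRegularSeq S → t ≤ Multiset.card S → subSums S = Set.univ} (3 * q + 3) := by
  refine ⟨fun S hS hc => ?_, fun t ht => ?_⟩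
  · have hcop : Nat.Coprime 3 q := (Nat.coprime_primes Nat.prime_three hq).2 (by omega)
    let e : ZMod 3 × ZMod (3 * q) ≃+ (ZMod 3 × ZMod 3) × ZMod q :=
      ((AddEquiv.refl (ZMod 3)).prodCongr (ZMod.chineseRemainder hcop).toAddEquiv).trans
        AddEquiv.prodAssoc.symm
    exact subSums_eq_univ_of_map_equiv e
      ((hS.map_equiv e).subSums_eq_univ hq hq5 (by rwa [card_map]))
  · by_contra! hlt
    have h := ht (extremalSeq q) (isRegularSeq_extremalSeq q hq5) (by
      rw [extremalSeq, card_add, card_replicate, card_replicate]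
      omega)
    exact notMem_subSums_extremalSeq q hq5 (h ▸ Set.mem_univ _)
end

section
/- Let q ≥ 5 be a prime number and let G = (ℤ/3ℤ) × (ℤ/3qℤ). The sequence S consisting of 3q − 2 copies of (0,1) and 4 copies of (1,−1) is a regular sequence over G of length 3q + 2, and the element (2, 3q − 3) does not belong to Σ(S); in particular, S is not an additive basis of G. -/
open Multiset

theorem mem_subSums_replicate_add_replicate {G : Type*} [AddCommMonoid G] {m n : ℕ} {x y z : G}
    (hz : z ∈ subSums (replicate m x + replicate n y)) :
    ∃ a ≤ m, ∃ b ≤ n, z = a • x + b • y := by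
  classical
  obtain ⟨T, hT, -, rfl⟩ := hz
  obtain ⟨a, ha, hTa⟩ := le_replicate_iff.1 (Multiset.inter_le_right (s := T) (t := replicate m x))
  obtain ⟨b, hb, hTb⟩ := le_replicate_iff.1 (tsub_le_iff_left.2 hT)
  refine ⟨a, ha, b, hb, ?_⟩
  rw [← Multiset.sub_add_inter T (replicate m x), hTa, hTb, sum_add, sum_replicate,
    sum_replicate, add_comm]

theorem eq_top_of_zero_one_mem_of_one_neg_one_mem {m n : ℕ} [NeZero m] [NeZero n]
    {H : AddSubgroup (ZMod m × ZMod n)}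
    (h₁ : ((0 : ZMod m), (1 : ZMod n)) ∈ H) (h₂ : ((1 : ZMod m), (-1 : ZMod n)) ∈ H) :
    H = ⊤ := by
  rw [AddSubgroup.eq_top_iff']
  rintro ⟨a, b⟩
  have h := H.add_mem (H.nsmul_mem h₂ a.val) (H.nsmul_mem h₁ (b + (a.val : ZMod n)).val)
  simpa [Prod.smul_mk, nsmul_eq_mul] using h

theorem le_card_of_mk_mem {m n : ℕ} [NeZero m] [NeZero n] {H : AddSubgroup (ZMod m × ZMod n)}
    {a : ZMod m} {b : ZMod n} (hb : addOrderOf b = n) (h : (a, b) ∈ H) : n ≤ Nat.card H := by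
  refine Nat.le_of_dvd Nat.card_pos ?_
  calc n = addOrderOf b := hb.symm
    _ ∣ addOrderOf (a, b) := addOrderOf_map_dvd (AddMonoidHom.snd (ZMod m) (ZMod n)) (a, b)
    _ ∣ Nat.card H := H.addOrderOf_dvd_natCard h

theorem isRegularSeq_replicate_add_replicate {n : ℕ} (hn : 5 ≤ n) :
    IsRegularSeq (replicate (n - 2) ((0 : ZMod 3), (1 : ZMod n))
      + replicate 4 ((1 : ZMod 3), (-1 : ZMod n))) := by
  classical
  have : NeZero n := ⟨by omega⟩
  intro H hH
  have h₁ : ((0 : ZMod 3), (1 : ZMod n)) ∈ H → n ≤ Nat.card H :=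
    le_card_of_mk_mem (ZMod.addOrderOf_one n)
  have h₂ : ((1 : ZMod 3), (-1 : ZMod n)) ∈ H → n ≤ Nat.card H :=
    le_card_of_mk_mem (by rw [addOrderOf_neg, ZMod.addOrderOf_one])
  have h₃ : ((0 : ZMod 3), (1 : ZMod n)) ∈ H → ((1 : ZMod 3), (-1 : ZMod n)) ∉ H :=
    fun h h' => hH (eq_top_of_zero_one_mem_of_one_neg_one_mem h h')
  rw [← countP_eq_card_filter, countP_add, ← coe_replicate, ← coe_replicate, coe_countP,
    coe_countP, List.countP_replicate, List.countP_replicate]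
  simp only [decide_eq_true_eq]
  split_ifs with h h' h'
  · exact absurd h' (h₃ h)
  · have := h₁ h
    omega
  · have := h₂ h'
    omega
  · omega

theorem two_neg_three_notMem_subSums {n : ℕ} (hn : 3 ≤ n) :
    ((2 : ZMod 3), ((n - 3 : ℕ) : ZMod n)) ∉
      subSums (replicate (n - 2) ((0 : ZMod 3), (1 : ZMod n))
        + replicate 4 ((1 : ZMod 3), (-1 : ZMod n))) := by
  intro h
  obtain ⟨a, ha, b, hb, hab⟩ := mem_subSums_replicate_add_replicate h
  simp only [Prod.smul_mk, Prod.mk_add_mk, Prod.mk.injEq, smul_zero, zero_add, nsmul_eq_mul,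
    mul_one, mul_neg] at hab
  obtain ⟨h₁, h₂⟩ := hab
  obtain rfl : b = 2 := by
    have h₃ : ((2 : ℕ) : ZMod 3) = b := h₁
    rw [ZMod.natCast_eq_natCast_iff'] at h₃
    omega
  have h₃ : ((a + 1 : ℕ) : ZMod n) = 0 := by
    rw [Nat.cast_sub hn, ZMod.natCast_self] at h₂
    push_cast at h₂ ⊢
    linear_combination -h₂
  rw [ZMod.natCast_eq_zero_iff] at h₃
  have := Nat.le_of_dvd a.succ_pos h₃
  omega

/-- For a prime q ≥ 5, the sequence over `(ℤ/3ℤ) × (ℤ/3qℤ)` consisting of `3q - 2` copies of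
`(0,1)` and `4` copies of `(1,-1)` is regular, has length `3q + 2`, the element `(2, 3q-3)`
is not in Σ(S), and S is not an additive basis. -/
theorem regular_not_basis (q : ℕ) (hq : q.Prime) (hq5 : 5 ≤ q)
    (S : Multiset (ZMod 3 × ZMod (3 * q)))
    (hS : S = Multiset.replicate (3 * q - 2) ((0 : ZMod 3), (1 : ZMod (3 * q)))
        + Multiset.replicate 4 ((1 : ZMod 3), (-1 : ZMod (3 * q)))) :
    IsRegularSeq S ∧ Multiset.card S = 3 * q + 2 ∧
      ((2 : ZMod 3), ((3 * q - 3 : ℕ) : ZMod (3 * q))) ∉ subSums S ∧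
      subSums S ≠ Set.univ := by
  subst hS
  have h := two_neg_three_notMem_subSums (n := 3 * q) (by omega)
  refine ⟨isRegularSeq_replicate_add_replicate (by omega), ?_, h,
    fun hU => h (hU ▸ Set.mem_univ _)⟩
  rw [card_add, card_replicate, card_replicate]
  omega
end

section
/- Let q ≥ 5 be a prime number and let G = C_3 ⊕ C_{3q} (concretely, G = (ℤ/3ℤ) × (ℤ/3qℤ)). Then c_0(G) ≥ 3q + 3; equivalently, there exists a regular sequence over G of length 3q + 2 that is not an additive basis of G. -/
open Multiset

/-- A subsequence of `a ^ m * b ^ n` is of the form `a ^ i * b ^ k` with `i ≤ m` and `k ≤ n`. -/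
theorem exists_replicate_of_le_replicate_add {α : Type*} {a b : α} {m n : ℕ} {T : Multiset α}
    (hT : T ≤ replicate m a + replicate n b) :
    ∃ i ≤ m, ∃ k ≤ n, T = replicate i a + replicate k b := by
  classical
  obtain ⟨i, hi, hi'⟩ := Multiset.le_replicate_iff.1 (Multiset.inter_le_right (s := T)
    (t := replicate m a))
  obtain ⟨k, hk, hk'⟩ := Multiset.le_replicate_iff.1 (tsub_le_iff_left.2 hT)
  refine ⟨i, hi, k, hk, ?_⟩
  rw [← hi', ← hk', add_comm, Multiset.sub_add_inter]

/-- An additive subgroup of `ZMod m × ZMod n` containing `(0, 1)` and `(1, 1)` is everything. -/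
theorem addSubgroup_eq_top_of_mem {m n : ℕ} {H : AddSubgroup (ZMod m × ZMod n)}
    (h₀ : ((0, 1) : ZMod m × ZMod n) ∈ H) (h₁ : ((1, 1) : ZMod m × ZMod n) ∈ H) : H = ⊤ := by
  refine (AddSubgroup.eq_top_iff' H).2 ?_
  rintro ⟨x, y⟩
  obtain ⟨u, rfl⟩ := ZMod.intCast_surjective x
  obtain ⟨v, rfl⟩ := ZMod.intCast_surjective y
  have h := H.add_mem (H.zsmul_mem h₁ u) (H.zsmul_mem h₀ (v - u))
  simpa using h

/-- An additive subgroup of `ZMod m × ZMod n` containing some `(x, 1)` has at least `n` elements. -/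
theorem le_natCard_of_mk_one_mem {m n : ℕ} [NeZero m] [NeZero n]
    {H : AddSubgroup (ZMod m × ZMod n)} {x : ZMod m} (hx : (x, (1 : ZMod n)) ∈ H) :
    n ≤ Nat.card H := by
  have hsurj : Function.Surjective (fun g : H => (g : ZMod m × ZMod n).2) := by
    intro y
    obtain ⟨v, rfl⟩ := ZMod.intCast_surjective y
    exact ⟨⟨_, H.zsmul_mem hx v⟩, by simp⟩
  simpa using Nat.card_le_card_of_surjective _ hsurj

/-- The sequence `(1, 1) ^ 4 * (0, 1) ^ (n - 2)` over `ZMod 3 × ZMod n` is regular. -/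
theorem isRegularSeq_replicate_add {n : ℕ} (hn : 5 ≤ n) :
    IsRegularSeq (replicate 4 ((1, 1) : ZMod 3 × ZMod n) + replicate (n - 2) (0, 1)) := by
  classical
  intro H hH
  have : NeZero n := ⟨by lia⟩
  rw [Multiset.filter_add, Multiset.card_add]
  have hfilter (k : ℕ) (x : ZMod 3 × ZMod n) :
      Multiset.card ((replicate k x).filter (· ∈ H)) = if x ∈ H then k else 0 := by
    split_ifs with hx
    · rw [Multiset.filter_eq_self.2 fun y hy => (eq_of_mem_replicate hy).symm ▸ hx,
        card_replicate]
    · rw [Multiset.filter_eq_nil.2 fun y hy => (eq_of_mem_replicate hy).symm ▸ hx, card_zero]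
  rw [hfilter, hfilter]
  by_cases h₁ : ((1, 1) : ZMod 3 × ZMod n) ∈ H <;> by_cases h₀ : ((0, 1) : ZMod 3 × ZMod n) ∈ H
  · exact absurd (addSubgroup_eq_top_of_mem h₀ h₁) hH
  · have := le_natCard_of_mk_one_mem h₁
    simp only [h₁, h₀, if_true, if_false]
    lia
  · have := le_natCard_of_mk_one_mem h₀
    simp only [h₁, h₀, if_true, if_false]
    lia
  · simp [h₁, h₀]

/-- The element `(2, 1)` is not a subsequence sum of `(1, 1) ^ 4 * (0, 1) ^ (n - 2)`. -/
theorem two_one_notMem_subSums {n : ℕ} (hn : 2 ≤ n) :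
    ((2, 1) : ZMod 3 × ZMod n) ∉
      subSums (replicate 4 ((1, 1) : ZMod 3 × ZMod n) + replicate (n - 2) (0, 1)) := by
  rintro ⟨T, hT, -, hsum⟩
  obtain ⟨i, hi, k, hk, rfl⟩ := exists_replicate_of_le_replicate_add hT
  simp only [sum_add, sum_replicate, Prod.smul_mk, nsmul_eq_mul, mul_one, mul_zero,
    Prod.mk_add_mk, add_zero, Prod.mk.injEq] at hsum
  obtain ⟨h₁, h₂⟩ := hsum
  have hi2 : i = 2 := by
    have h : i ≡ 2 [MOD 3] := (ZMod.natCast_eq_natCast_iff _ _ _).1 (by exact_mod_cast h₁)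
    unfold Nat.ModEq at h
    lia
  subst hi2
  have h : ((k + 1 : ℕ) : ZMod n) = 0 := by
    push_cast at h₂ ⊢
    linear_combination h₂
  have := Nat.le_of_dvd k.succ_pos ((ZMod.natCast_eq_zero_iff _ _).1 h)
  lia

/-- For a prime q ≥ 5 and G = (ℤ/3ℤ) × (ℤ/3qℤ), we have c₀(G) ≥ 3q + 3: every `t` such
that all regular sequences of length ≥ t are additive bases satisfies `t ≥ 3q + 3`;
equivalently, there is a regular sequence over G of length `3q + 2` which is not an
additive basis of G. -/
theorem c0_ge (q : ℕ) (hq : q.Prime) (hq5 : 5 ≤ q) :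
    (∀ t : ℕ, (∀ S : Multiset (ZMod 3 × ZMod (3 * q)),
        IsRegularSeq S → t ≤ Multiset.card S → subSums S = Set.univ) → 3 * q + 3 ≤ t) ∧
    (∃ S : Multiset (ZMod 3 × ZMod (3 * q)),
        IsRegularSeq S ∧ Multiset.card S = 3 * q + 2 ∧ subSums S ≠ Set.univ) := by
  have hS : ∃ S : Multiset (ZMod 3 × ZMod (3 * q)),
      IsRegularSeq S ∧ Multiset.card S = 3 * q + 2 ∧ subSums S ≠ Set.univ := by
    refine ⟨_, isRegularSeq_replicate_add (by lia), ?_, fun h => ?_⟩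
    · simp only [card_add, card_replicate]
      lia
    · exact two_one_notMem_subSums (n := 3 * q) (by lia) (h ▸ Set.mem_univ _)
  refine ⟨fun t ht => ?_, hS⟩
  obtain ⟨S, hreg, hcard, hne⟩ := hS
  by_contra! hlt
  exact hne (ht S hreg (by lia))
end

section
/- Let q ≥ 5 be a prime number, let G = C_3 ⊕ C_{3q} (concretely, G = (ℤ/3ℤ) × (ℤ/3qℤ)), and let S be a regular sequence over G of length 3q + 3. If there exists a nontrivial subgroup H' of G such that Σ_0(S_{H'}) = H', then Σ(S) = G. -/
open Multiset

/-- A submultiset of an image is the image of a submultiset. -/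
theorem Multiset.exists_le_map_eq_of_le_map {α β : Type*} {f : α → β} {S : Multiset α}
    {U : Multiset β} (h : U ≤ S.map f) : ∃ V ≤ S, V.map f = U := by
  classical
  induction S using Multiset.induction_on generalizing U with
  | empty => exact ⟨0, le_rfl, by simpa [eq_comm] using h⟩
  | cons a S ih =>
    rw [map_cons] at h
    by_cases ha : f a ∈ U
    · obtain ⟨V, hV, hVU⟩ := ih (Multiset.erase_le_iff_le_cons.2 h)
      exact ⟨a ::ₘ V, cons_le_cons a hV, by rw [map_cons, hVU, cons_erase ha]⟩
    · obtain ⟨V, hV, hVU⟩ := ih ((le_cons_of_notMem ha).1 h)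
      exact ⟨V, hV.trans (le_cons_self _ _), hVU⟩

/-- Either the subsequence sums of `T` outnumber its terms, or some nonempty subsequence `U` has
all of the subgroup it generates as subsequence sums, even after deleting any one term. -/
theorem card_lt_ncard_or_exists_full {A : Type*} [AddCommGroup A] [Finite A] [DecidableEq A]
    (T : Multiset A) :
    card T < {x | ∃ V ≤ T, V.sum = x}.ncard ∨
      ∃ U ≤ T, U ≠ 0 ∧ ∀ g ∈ U, ∀ x ∈ AddSubgroup.closure {y | y ∈ U},
        ∃ V ≤ U.erase g, V.sum = x := by
  induction T using Multiset.strongInductionOn with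
  | ih T ih =>
    by_contra! ⟨hcard, hno⟩
    have hT : T ≠ 0 := by
      rintro rfl
      simp at hcard
    obtain ⟨g, hg, x, hx, hmiss⟩ := hno T le_rfl hT
    have heq : ∀ g ∈ T, {x | ∃ V ≤ T.erase g, V.sum = x} = {x | ∃ V ≤ T, V.sum = x} := by
      intro g hg
      refine Set.eq_of_subset_of_ncard_le ?_ ?_ (Set.toFinite _)
      · rintro _ ⟨V, hV, rfl⟩
        exact ⟨V, hV.trans (erase_le _ _), rfl⟩
      · rcases ih _ (erase_lt.2 hg) with h | ⟨U, hU, hU0, h⟩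
        · have := card_erase_add_one hg
          omega
        · obtain ⟨g', hg', x', hx', h'⟩ := hno U (hU.trans (erase_le _ _)) hU0
          obtain ⟨V, hV, hVx⟩ := h g' hg' x' hx'
          exact absurd hVx (h' V hV)
    have hmem : x ∈ {x | ∃ V ≤ T, V.sum = x} := by
      rw [← AddSubgroup.mem_toAddSubmonoid, AddSubgroup.closure_toAddSubmonoid_of_finite] at hx
      induction hx using AddSubmonoid.closure_induction_left with
      | zero => exact ⟨0, zero_le _, rfl⟩
      | add_left y hy z _ ihz =>
        have hz : z ∈ {x | ∃ V ≤ T, V.sum = x} := by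
          by_contra hz
          exact hz (ihz fun V hV hVz => hz ⟨V, hV.trans (erase_le _ _), hVz⟩)
        rw [← heq y hy] at hz
        obtain ⟨V, hV, rfl⟩ := hz
        refine ⟨y ::ₘ V, ?_, by simp⟩
        rw [← cons_erase hy]
        exact cons_le_cons y hV
    rw [← heq g hg] at hmem
    obtain ⟨V, hV, hVx⟩ := hmem
    exact hmiss V hV hVx

/-- A sequence over a finite abelian group that is at least as long as the order of the group has
a nonempty zero-sum subsequence. -/
theorem exists_zero_sum_of_natCard_le {A : Type*} [AddCommGroup A] [Finite A]
    (T : Multiset A) (hT : Nat.card A ≤ card T) : ∃ U ≤ T, U ≠ 0 ∧ U.sum = 0 := by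
  classical
  rcases card_lt_ncard_or_exists_full T with h | ⟨U, hU, hU0, h⟩
  · have := Set.ncard_le_card {x | ∃ V ≤ T, V.sum = x}
    omega
  · obtain ⟨g, hg⟩ := exists_mem_of_ne_zero hU0
    obtain ⟨V, hV, hVg⟩ := h g hg (-g) (neg_mem (AddSubgroup.subset_closure hg))
    refine ⟨g ::ₘ V, ?_, cons_ne_zero, by simp [hVg]⟩
    refine le_trans ?_ hU
    rw [← cons_erase hg]
    exact cons_le_cons g hV

/-- If the terms of `S` lying in `H` represent all of `H`, and outside every proper subgroup
`K ≥ H` there are at least `K.index - 1` terms of `S`, then `S` represents every element. -/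
theorem exists_sum_eq_of_index_le {G : Type*} [AddCommGroup G] [Finite G] (S : Multiset G)
    (H : AddSubgroup G) (hH : ∀ x ∈ H, ∃ V ≤ S, (∀ y ∈ V, y ∈ H) ∧ V.sum = x)
    (hS : ∀ K : AddSubgroup G, H ≤ K → K ≠ ⊤ → ∃ T ≤ S, (∀ y ∈ T, y ∉ K) ∧ K.index ≤ card T + 1)
    (x : G) : ∃ V ≤ S, V.sum = x := by
  classical
  induction hn : H.index using Nat.strong_induction_on generalizing H with
  | h n ih =>
  subst hn
  by_cases htop : H = ⊤
  · obtain ⟨V, hV, -, hVx⟩ := hH x (htop ▸ AddSubgroup.mem_top x)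
    exact ⟨V, hV, hVx⟩
  obtain ⟨T, hTS, hTH, hcard⟩ := hS H le_rfl htop
  let π := QuotientAddGroup.mk' H
  have hπ (y : G) : π y = 0 ↔ y ∈ H := QuotientAddGroup.eq_zero_iff y
  have hT0 : T ≠ 0 := by
    rintro rfl
    have := mt AddSubgroup.index_eq_one.1 htop
    have := H.index_ne_zero_of_finite
    simp at hcard
    omega
  obtain ⟨U, hUT, hU0, hU⟩ : ∃ U ≤ T, U ≠ 0 ∧
      ∀ z ∈ AddSubgroup.closure {y | y ∈ U.map π}, ∃ V ≤ U.map π, V.sum = z := by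
    rcases card_lt_ncard_or_exists_full (T.map π) with h | ⟨U', hU', hU'0, h⟩
    · refine ⟨T, le_rfl, hT0, fun z _ => ?_⟩
      have huniv : {x | ∃ V ≤ T.map π, V.sum = x} = Set.univ := by
        apply Set.eq_of_subset_of_ncard_le (Set.subset_univ _)
        rw [Set.ncard_univ]
        change H.index ≤ _
        rw [card_map] at h
        omega
      exact huniv.ge (Set.mem_univ z)
    · obtain ⟨U, hU, rfl⟩ := exists_le_map_eq_of_le_map hU'
      refine ⟨U, hU, by simpa using hU'0, fun z hz => ?_⟩
      obtain ⟨g, hg⟩ := exists_mem_of_ne_zero hU'0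
      obtain ⟨V, hV, hVz⟩ := h g hg z hz
      exact ⟨V, hV.trans (erase_le _ _), hVz⟩
  let K := (AddSubgroup.closure {y | y ∈ U.map π}).comap π
  have hHK : H ≤ K := fun y hy => by
    change π y ∈ AddSubgroup.closure {y | y ∈ U.map π}
    rw [(hπ y).2 hy]
    exact zero_mem _
  have hUK : ∀ y ∈ U, y ∈ K := fun y hy =>
    AddSubgroup.subset_closure (mem_map_of_mem π hy)
  have hlt : H < K := by
    obtain ⟨g, hg⟩ := exists_mem_of_ne_zero hU0
    exact lt_of_le_not_ge hHK fun hKH => hTH g (mem_of_le hUT hg) (hKH (hUK g hg))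
  refine ih K.index (AddSubgroup.index_strictAnti hlt) K ?_ (fun L hL => hS L (hHK.trans hL)) rfl
  intro z hz
  obtain ⟨V', hV', hVz⟩ := hU (π z) hz
  obtain ⟨V, hV, rfl⟩ := exists_le_map_eq_of_le_map hV'
  have hdiff : z - V.sum ∈ H := by
    rw [← hπ, map_sub, map_multiset_sum, hVz, sub_self]
  obtain ⟨W, hW, hWH, hWz⟩ := hH _ hdiff
  refine ⟨V + W, ?_, ?_, by simp [hWz]⟩
  · rw [← filter_add_not (fun y => y ∉ H) S]
    refine add_le_add (le_filter.2 ⟨(hV.trans hUT).trans hTS, fun y hy => ?_⟩)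
      (le_filter.2 ⟨hW, fun y hy => ?_⟩)
    · exact hTH y (mem_of_le (hV.trans hUT) hy)
    · simpa using hWH y hy
  · intro y hy
    rcases mem_add.1 hy with hy | hy
    · exact hUK y (mem_of_le hV hy)
    · exact hHK (hWH y hy)

theorem exists_finset_zero_sum_of_five_le {n : ℕ} (hn : 5 ≤ n) (f : Fin n → ZMod 3 × ZMod 3) :
    ∃ s : Finset (Fin n), s.Nonempty ∧ ∑ i ∈ s, f i = 0 := by
  classical
  let P (a : Fin n → ZMod 3) : MvPolynomial (Fin n) (ZMod 3) :=
    ∑ i, a i • MvPolynomial.X i ^ 2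
  have hdeg (a : Fin n → ZMod 3) : (P a).totalDegree ≤ 2 := by
    apply MvPolynomial.totalDegree_finsetSum_le
    intro i _
    exact (MvPolynomial.totalDegree_smul_le ..).trans (MvPolynomial.totalDegree_X_pow ..).le
  let a := fun i => (f i).1
  let b := fun i => (f i).2
  have hdvd := char_dvd_card_solutions_of_add_lt 3 (f₁ := P a) (f₂ := P b) (by
    have := hdeg a
    have := hdeg b
    rw [Fintype.card_fin]
    omega)
  let z : {x // MvPolynomial.eval x (P a) = 0 ∧ MvPolynomial.eval x (P b) = 0} :=
    ⟨0, by simp [P, map_sum]⟩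
  obtain ⟨x, hx⟩ := Fintype.exists_ne_of_one_lt_card ((by norm_num : 1 < 3).trans_le <|
    Nat.le_of_dvd (Fintype.card_pos_iff.2 ⟨z⟩) hdvd) z
  refine ⟨Finset.univ.filter fun i => x.1 i ≠ 0, ?_, ?_⟩
  · rw [← Subtype.coe_ne_coe, Function.ne_iff] at hx
    obtain ⟨i, hi⟩ := hx
    exact ⟨i, Finset.mem_filter.2 ⟨Finset.mem_univ i, hi⟩⟩
  · have hsq : ∀ y : ZMod 3, y ^ 2 = if y ≠ 0 then 1 else 0 := by decide
    have h := x.2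
    simp only [P, map_sum, MvPolynomial.smul_eval, map_pow, MvPolynomial.eval_X, hsq, mul_ite,
      mul_one, mul_zero, ← Finset.sum_filter] at h
    exact Prod.ext (by simpa [Prod.fst_sum] using h.1) (by simpa [Prod.snd_sum] using h.2)

theorem exists_finset_zero_sum_card_le_three {n : ℕ} (hn : 9 ≤ n)
    (f : Fin n → ZMod 3 × ZMod 3) :
    ∃ s : Finset (Fin n), s.Nonempty ∧ s.card ≤ 3 ∧ ∑ i ∈ s, f i = 0 := by
  classical
  by_contra! hno
  have h0 : ∀ i, f i ≠ 0 := fun i => by simpa using hno {i} (by simp) (by simp)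
  have hopp : ∀ i j, i ≠ j → f i + f j ≠ 0 := fun i j hij => by
    simpa [Finset.sum_pair hij] using
      hno {i, j} (by simp) (Finset.card_le_two.trans (by norm_num))
  let c : ZMod 3 × ZMod 3 → Option (ZMod 3) := fun x => if x.1 = 0 then none else some (x.1 * x.2)
  have hc : ∀ x y, x ≠ 0 → y ≠ 0 → c x = c y → x = y ∨ x + y = 0 := by decide
  have h3 : ∀ x : ZMod 3 × ZMod 3, x + (x + x) = 0 := by decide
  obtain ⟨y, -, hy⟩ := Finset.exists_lt_card_fiber_of_mul_lt_card_of_maps_to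
    (s := (Finset.univ : Finset (Fin n))) (t := Finset.univ) (f := fun i => c (f i)) (n := 2)
    (fun _ _ => Finset.mem_univ _) (by
      rw [Finset.card_univ, Finset.card_univ, Fintype.card_option, ZMod.card, Fintype.card_fin]
      omega)
  obtain ⟨i, j, k, hi, hj, hk, hij, hik, hjk⟩ := Finset.two_lt_card_iff.1 hy
  simp only [Finset.mem_filter, Finset.mem_univ, true_and] at hi hj hk
  have h1 := (hc _ _ (h0 i) (h0 j) (hi.trans hj.symm)).resolve_right (hopp i j hij)
  have h2 := (hc _ _ (h0 i) (h0 k) (hi.trans hk.symm)).resolve_right (hopp i k hik)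
  refine hno {i, j, k} (by simp) Finset.card_le_three ?_
  rw [Finset.sum_insert (by simp [hij, hik]), Finset.sum_pair hjk, ← h1, ← h2, h3]

theorem exists_le_card_eq_map_sum_eq {G A : Type*} [AddCommMonoid G] [AddCommMonoid A] (φ : G →+ A)
    (S : Multiset G) (s : Finset (Fin S.toList.length)) :
    ∃ b ≤ S, card b = s.card ∧ φ b.sum = ∑ i ∈ s, φ S.toList[i] := by
  refine ⟨s.val.map fun i => S.toList[i], ?_, by simp, ?_⟩
  · have hS : (Finset.univ : Finset (Fin S.toList.length)).val.map (fun i => S.toList[i]) = S := by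
      conv_rhs => rw [← coe_toList S]
      rw [Fin.univ_val_map]
      exact congrArg _ List.ofFn_getElem
    exact (map_le_map (Finset.val_le_iff.2 (Finset.subset_univ s))).trans_eq hS
  · change φ (∑ i ∈ s, S.toList[i]) = _
    rw [map_sum]

/-- A sequence of length at least `3k + 3` contains `k` disjoint nonempty blocks whose sums are
killed by a given homomorphism to `C₃ ⊕ C₃`. -/
theorem exists_blocks {G : Type*} [AddCommGroup G] (φ : G →+ ZMod 3 × ZMod 3) (k : ℕ)
    (S : Multiset G) (hS : 3 * k + 3 ≤ card S) :
    ∃ B : Multiset (Multiset G), card B = k ∧ B.join ≤ S ∧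
      ∀ b ∈ B, b ≠ 0 ∧ φ b.sum = 0 := by
  classical
  induction k generalizing S with
  | zero => exact ⟨0, by simp⟩
  | succ k ih =>
    rcases Nat.eq_zero_or_pos k with rfl | hk
    · obtain ⟨s, hs, hsum⟩ := exists_finset_zero_sum_of_five_le
        (n := S.toList.length) (by simp; omega) fun i => φ S.toList[i]
      obtain ⟨b, hb, hbc, hbs⟩ := exists_le_card_eq_map_sum_eq φ S s
      refine ⟨{b}, by simp, by simpa using hb, ?_⟩
      simp only [mem_singleton, forall_eq]
      exact ⟨by rw [← card_pos, hbc]; exact hs.card_pos, hbs.trans hsum⟩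
    · obtain ⟨s, hs, hs3, hsum⟩ := exists_finset_zero_sum_card_le_three
        (n := S.toList.length) (by simp; omega) fun i => φ S.toList[i]
      obtain ⟨b, hb, hbc, hbs⟩ := exists_le_card_eq_map_sum_eq φ S s
      obtain ⟨B, hBc, hBS, hB⟩ := ih (S - b) (by rw [card_sub hb]; omega)
      refine ⟨b ::ₘ B, by simp [hBc], ?_, ?_⟩
      · rw [join_cons, ← add_tsub_cancel_of_le hb]
        exact add_le_add le_rfl hBS
      · simp only [mem_cons, forall_eq_or_imp]
        exact ⟨⟨by rw [← card_pos, hbc]; exact hs.card_pos, hbs.trans hsum⟩, hB⟩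

theorem exists_zero_sum_of_three_mul_add_three_le {q : ℕ} (hq : Nat.Coprime 3 q) [NeZero q]
    (S : Multiset (ZMod 3 × ZMod (3 * q))) (hS : 3 * q + 3 ≤ card S) :
    ∃ T ≤ S, T ≠ 0 ∧ T.sum = 0 := by
  let r : ZMod (3 * q) →+ ZMod 3 := (ZMod.castHom (dvd_mul_right 3 q) (ZMod 3)).toAddMonoidHom
  let t : ZMod (3 * q) →+ ZMod q := (ZMod.castHom (dvd_mul_left q 3) (ZMod q)).toAddMonoidHom
  have hrt : ∀ x, r x = 0 → t x = 0 → x = 0 := by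
    intro x hr ht
    obtain ⟨m, rfl⟩ := ZMod.natCast_zmod_surjective x
    have hr' : (m : ZMod 3) = 0 := by simpa [r] using hr
    have ht' : (m : ZMod q) = 0 := by simpa [t] using ht
    rw [ZMod.natCast_eq_zero_iff] at *
    exact hq.mul_dvd_of_dvd_of_dvd hr' ht'
  let φ : ZMod 3 × ZMod (3 * q) →+ ZMod 3 × ZMod 3 := (AddMonoidHom.id _).prodMap r
  let ψ : ZMod 3 × ZMod (3 * q) →+ ZMod q := t.comp (AddMonoidHom.snd _ _)
  obtain ⟨B, hBc, hBS, hB⟩ := exists_blocks φ q S hS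
  obtain ⟨U, hU, hU0, hUs⟩ := exists_zero_sum_of_natCard_le (B.map fun b => ψ b.sum)
    (by simp [hBc])
  obtain ⟨C, hC, rfl⟩ := exists_le_map_eq_of_le_map hU
  have hφ : φ C.join.sum = 0 := by
    rw [sum_join, map_multiset_sum, map_map]
    exact sum_eq_zero fun y hy => by
      obtain ⟨b, hb, rfl⟩ := mem_map.1 hy
      exact (hB b (mem_of_le hC hb)).2
  have hψ : ψ C.join.sum = 0 := by
    rw [sum_join, map_multiset_sum, map_map]
    exact hUs
  refine ⟨C.join, ?_, ?_, ?_⟩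
  · refine le_trans ?_ hBS
    obtain ⟨D, rfl⟩ := Multiset.le_iff_exists_add.1 hC
    rw [join_add]
    exact le_self_add
  · obtain ⟨b, hb⟩ := exists_mem_of_ne_zero (s := C) (by simpa using hU0)
    obtain ⟨y, hy⟩ := exists_mem_of_ne_zero (hB b (mem_of_le hC hb)).1
    intro h
    have : y ∈ C.join := mem_join.2 ⟨b, hb, hy⟩
    simp [h] at this
  · exact Prod.ext (congrArg (fun x : ZMod 3 × ZMod 3 => x.1) hφ :)
      (hrt _ (congrArg (fun x : ZMod 3 × ZMod 3 => x.2) hφ :) hψ)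

theorem add_le_of_mul_eq_nine_mul {q n m : ℕ} (hq : Odd q) (h : n * m = 9 * q) (hn : n ≠ 1)
    (hm : m ≠ 1) : n + m ≤ 3 * q + 3 := by
  have hodd : Odd (n * m) := h ▸ (by decide : Odd 9).mul hq
  obtain ⟨⟨a, rfl⟩, ⟨b, rfl⟩⟩ := Nat.odd_mul.1 hodd
  obtain ⟨a, rfl⟩ := Nat.exists_eq_succ_of_ne_zero (show a ≠ 0 by omega)
  obtain ⟨b, rfl⟩ := Nat.exists_eq_succ_of_ne_zero (show b ≠ 0 by omega)
  simp only [Nat.succ_eq_add_one] at *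
  nlinarith [Nat.zero_le (a * b)]

open scoped Classical in
/-- For a prime q ≥ 5 and a regular sequence S of length 3q+3 over `(ℤ/3ℤ) × (ℤ/3qℤ)`:
if there is a nontrivial subgroup H' with Σ₀(S_{H'}) = H', then Σ(S) = G. -/
theorem basis_of_subgroup_full (q : ℕ) (hq : q.Prime) (hq5 : 5 ≤ q)
    (S : Multiset (ZMod 3 × ZMod (3 * q)))
    (hreg : IsRegularSeq S) (hlen : Multiset.card S = 3 * q + 3)
    (H' : AddSubgroup (ZMod 3 × ZMod (3 * q))) (hH' : H' ≠ ⊥)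
    (hfull : insert (0 : ZMod 3 × ZMod (3 * q))
        (subSums (S.filter (fun x => x ∈ H'))) = (H' : Set (ZMod 3 × ZMod (3 * q)))) :
    subSums S = Set.univ := by
  have hodd : Odd q := hq.odd_of_ne_two (by omega)
  have hq3 : Nat.Coprime 3 q := (Nat.coprime_primes Nat.prime_three hq).2 (by omega)
  have : NeZero q := ⟨hq.ne_zero⟩
  obtain ⟨Z, hZ, hZ0, hZs⟩ := exists_zero_sum_of_three_mul_add_three_le hq3 S hlen.ge
  have hrep := exists_sum_eq_of_index_le S H' ?_ ?_
  · refine Set.eq_univ_of_forall fun x => ?_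
    obtain ⟨V, hV, rfl⟩ := hrep x
    rcases eq_or_ne V 0 with rfl | hV0
    · exact ⟨Z, hZ, hZ0, by simpa using hZs⟩
    · exact ⟨V, hV, hV0, rfl⟩
  · intro x hx
    rw [← SetLike.mem_coe, ← hfull] at hx
    rcases hx with rfl | ⟨T, hT, -, hTx⟩
    · exact ⟨0, zero_le _, by simp, rfl⟩
    · exact ⟨T, hT.trans (filter_le _ _), fun y hy => (mem_filter.1 (mem_of_le hT hy)).2, hTx⟩
  · intro K hHK hK
    refine ⟨S.filter (fun x => x ∉ K), filter_le _ _, fun y hy => (mem_filter.1 hy).2, ?_⟩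
    have hbound := add_le_of_mul_eq_nine_mul (n := Nat.card K) (m := K.index) hodd
      (by rw [K.card_mul_index, Nat.card_prod, Nat.card_zmod, Nat.card_zmod]; ring)
      (fun h => hH' (le_bot_iff.1 (hHK.trans_eq (K.eq_bot_of_card_eq h))))
      (fun h => hK (AddSubgroup.index_eq_one.1 h))
    have hreg' := hreg K hK
    have hsplit := congrArg card (filter_add_not (fun x => x ∈ K) S)
    rw [card_add, hlen] at hsplit
    have : 0 < Nat.card K := Nat.card_pos
    omega
end

section
/- Let q ≥ 5 be a prime number, let G = C_3 ⊕ C_{3q} (concretely, G = (ℤ/3ℤ) × (ℤ/3qℤ)), and let S = g_1 · … · g_ℓ be a regular sequence over G of length ℓ = 3q + 3 (with indexed terms). Suppose there exist a subsequence S' of S (given by an index set I_{S'} ⊆ {1, …, ℓ}), a nontrivial subgroup H' of G, and an element a ∈ G such that Σ_0(S') ⊇ a + H', and such that, setting M = st((a + H') + Σ_0(S S'^{-1})) where S S'^{-1} is the subsequence of S on the complementary index set, one has (ℓ − |I_{S_M} ∪ I_{S'}| + 1)·|M| ≥ 9q, where I_{S_M} = {i ∈ {1, …, ℓ} : g_i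 ∈ M}. Then Σ(S) = G. -/
open Multiset Pointwise

section SubsetSums

variable {ι G : Type*}

/-- `subsetSums g J` is the set of all sums of `g` over (possibly empty) subsets of `J`. -/
def subsetSums [AddCommMonoid G] (g : ι → G) (J : Finset ι) : Set G :=
  {x | ∃ T ⊆ J, ∑ i ∈ T, g i = x}

lemma zero_mem_subsetSums [AddCommMonoid G] (g : ι → G) (J : Finset ι) : 0 ∈ subsetSums g J :=
  ⟨∅, Finset.empty_subset _, Finset.sum_empty⟩

lemma sum_mem_subSums [AddCommMonoid G] {g : ι → G} {T J : Finset ι} (hT : T.Nonempty)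
    (hTJ : T ⊆ J) : ∑ i ∈ T, g i ∈ subSums (J.val.map g) := by
  refine ⟨T.val.map g, Multiset.map_le_map (Finset.val_le_iff.2 hTJ), ?_, rfl⟩
  simpa using hT.ne_empty

lemma insert_zero_subSums [AddCommMonoid G] (g : ι → G) (J : Finset ι) :
    insert 0 (subSums (J.val.map g)) = subsetSums g J := by
  classical
  ext x
  constructor
  · rintro (rfl | ⟨T, hT, -, rfl⟩)
    · exact zero_mem_subsetSums g J
    · have key : ∀ (s : Multiset ι) (T : Multiset G), T ≤ s.map g → ∃ t ≤ s, t.map g = T := by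
        intro s
        induction s using Multiset.induction with
        | empty => exact fun T hT => ⟨0, le_rfl, by simpa [eq_comm] using hT⟩
        | cons i s ih =>
          intro T hT
          rw [Multiset.map_cons] at hT
          by_cases hi : g i ∈ T
          · obtain ⟨T', rfl⟩ := Multiset.exists_cons_of_mem hi
            obtain ⟨t, ht, rfl⟩ := ih T' ((Multiset.cons_le_cons_iff _).1 hT)
            exact ⟨i ::ₘ t, Multiset.cons_le_cons _ ht, Multiset.map_cons _ _ _⟩
          · obtain ⟨t, ht, rfl⟩ := ih T ((Multiset.le_cons_of_notMem hi).1 hT)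
            exact ⟨t, ht.trans (Multiset.le_cons_self _ _), rfl⟩
      obtain ⟨t, ht, rfl⟩ := key _ _ hT
      exact ⟨⟨t, Multiset.nodup_of_le ht J.nodup⟩, Finset.val_le_iff.1 ht, rfl⟩
  · rintro ⟨T, hT, rfl⟩
    rcases T.eq_empty_or_nonempty with rfl | hne
    · simp
    · exact Or.inr (sum_mem_subSums hne hT)

lemma subsetSums_insert [AddCommMonoid G] [DecidableEq ι] (g : ι → G) {J : Finset ι} {i : ι}
    (hi : i ∉ J) : subsetSums g (insert i J) = subsetSums g J ∪ (g i +ᵥ subsetSums g J) := by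
  ext x
  constructor
  · rintro ⟨T, hT, rfl⟩
    by_cases hiT : i ∈ T
    · refine Or.inr ⟨∑ j ∈ T.erase i, g j, ⟨T.erase i, ?_, rfl⟩, Finset.add_sum_erase T g hiT⟩
      exact (Finset.erase_subset_erase i hT).trans (Finset.erase_insert hi).subset
    · exact Or.inl ⟨T, (Finset.subset_insert_iff_of_notMem hiT).1 hT, rfl⟩
  · rintro (⟨T, hT, rfl⟩ | ⟨_, ⟨T, hT, rfl⟩, rfl⟩)
    · exact ⟨T, hT.trans (Finset.subset_insert _ _), rfl⟩
    · exact ⟨insert i T, Finset.insert_subset_insert i hT,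
        Finset.sum_insert fun h => hi (hT h)⟩

/-- The case of Kneser's theorem for sums of the two-element sets `{0, g i}`
with trivial stabilizer. -/
lemma card_filter_ne_zero_lt_ncard_subsetSums [AddCommGroup G] [Finite G] [DecidableEq G]
    (g : ι → G) (J : Finset ι)
    (hstab : ∀ x : G, x +ᵥ subsetSums g J = subsetSums g J → x = 0) :
    (J.filter fun i => g i ≠ 0).card < (subsetSums g J).ncard := by
  classical
  induction J using Finset.induction with
  | empty =>
    simpa using (Set.ncard_pos (Set.toFinite _)).2 ⟨_, zero_mem_subsetSums g ∅⟩
  | insert i J hi ih =>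
    have hins := subsetSums_insert g hi
    have hIH := ih fun x hx => hstab x (by
      rw [hins, Set.vadd_set_union, vadd_comm, hx])
    by_cases h0 : g i = 0
    · rw [Finset.filter_insert, if_neg (not_not.2 h0), hins, h0, zero_vadd, Set.union_self]
      exact hIH
    · rw [Finset.filter_insert, if_pos h0, Finset.card_insert_of_notMem (by simp [hi])]
      refine lt_of_le_of_lt (Nat.succ_le_of_lt hIH) (Set.ncard_lt_ncard ?_ (Set.toFinite _))
      rw [hins]
      refine ⟨Set.subset_union_left, fun hsub => h0 (hstab _ ?_)⟩
      have hfix : g i +ᵥ subsetSums g J = subsetSums g J :=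
        Set.eq_of_subset_of_ncard_le (Set.subset_union_right.trans hsub)
          (Set.ncard_vadd_set _ _).ge (Set.toFinite _)
      rw [hins, hfix, Set.union_self, hfix]

open scoped Classical in
/-- If the subset sums translated along a subgroup have stabilizer `M`, and sufficiently many terms
lie outside `M`, then these sums cover the whole group. -/
lemma eq_univ_of_card_le_card_filter_mul_card [AddCommGroup G] [Finite G]
    {g : ι → G} {J : Finset ι} {H M : AddSubgroup G} {a : G} {A : Set G}
    (hA : A = (a +ᵥ (H : Set G)) + subsetSums g J)
    (hM : (M : Set G) = {x | x +ᵥ A = A})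
    (hcard : Nat.card G ≤ ((J.filter fun i => g i ∉ M).card + 1) * Nat.card M) : A = Set.univ := by
  have hMmem : ∀ x, x ∈ M ↔ x +ᵥ A = A := fun x => by
    rw [← SetLike.mem_coe, hM, Set.mem_ofPred_eq]
  have hHM : H ≤ M := by
    intro h hh
    rw [hMmem, hA, ← vadd_add_assoc, vadd_comm, vadd_coe_set hh]
  let π : G →+ G ⧸ M := QuotientAddGroup.mk' M
  have hsum : ∀ T : Finset ι, π (∑ i ∈ T, g i) = ∑ i ∈ T, π (g i) := fun T => map_sum π g T
  have hker : ∀ x, π x = 0 ↔ x ∈ M := fun x => by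
    simp [π]
  have hmem : ∀ y, y ∈ A ↔ π (y - a) ∈ subsetSums (π ∘ g) J := by
    intro y
    constructor
    · intro hy
      rw [hA] at hy
      obtain ⟨_, ⟨h, hh, rfl⟩, _, ⟨T, hT, rfl⟩, rfl⟩ := hy
      refine ⟨T, hT, ?_⟩
      have := (hker h).2 (hHM hh)
      simp [vadd_eq_add, hsum, this]
    · rintro ⟨T, hT, hy⟩
      have h1 : a + ∑ i ∈ T, g i ∈ A := by
        rw [hA]
        exact Set.add_mem_add ⟨0, H.zero_mem, by simp⟩ ⟨T, hT, rfl⟩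
      have h2 : y - a - ∑ i ∈ T, g i ∈ M := by
        rw [← hker, map_sub, hsum, ← hy]
        simp
      rw [hMmem] at h2
      rw [← h2]
      exact ⟨_, h1, by simp only [vadd_eq_add]; abel⟩
  have hlt := card_filter_ne_zero_lt_ncard_subsetSums (π ∘ g) J (by
    intro k hk
    obtain ⟨x, rfl⟩ := QuotientAddGroup.mk'_surjective M k
    rw [hker, hMmem]
    ext y
    rw [Set.mem_vadd_set_iff_neg_vadd_mem, hmem, hmem]
    nth_rw 2 [← hk]
    rw [Set.mem_vadd_set_iff_neg_vadd_mem]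
    simp only [vadd_eq_add, ← map_neg]
    have : -x + y - a = -x + (y - a) := by abel
    rw [this]
    rfl)
  simp only [Function.comp_apply, Ne, hker] at hlt
  have huniv : subsetSums (π ∘ g) J = Set.univ := by
    refine Set.eq_of_subset_of_ncard_le (Set.subset_univ _) ?_ (Set.toFinite _)
    rw [Set.ncard_univ]
    rw [AddSubgroup.card_eq_card_quotient_mul_card_addSubgroup M] at hcard
    have := Nat.le_of_mul_le_mul_right hcard Nat.card_pos
    omega
  ext y
  simp [hmem, huniv]

end SubsetSums

section ZeroSums

variable {ι : Type*}

/-- A family of more than `r * (p - 1)` elements of `(ℤ/pℤ)^r` has a nonempty zero-sum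
subfamily. -/
lemma exists_nonempty_sum_eq_zero_of_mul_lt_card {p : ℕ} [Fact p.Prime] {r : ℕ}
    (h : Fin r → ι → ZMod p) {J : Finset ι} (hJ : r * (p - 1) < J.card) :
    ∃ T ⊆ J, T.Nonempty ∧ ∀ k, ∑ i ∈ T, h k i = 0 := by
  classical
  let f : Fin r → MvPolynomial J (ZMod p) := fun k =>
    ∑ i : J, h k i • MvPolynomial.X i ^ (p - 1)
  have hp : 1 < p := (Fact.out : p.Prime).one_lt
  have hdeg : ∑ k, (f k).totalDegree < Fintype.card J := by
    refine lt_of_le_of_lt (Finset.sum_le_card_nsmul _ _ (p - 1) fun k _ => ?_) (by simpa using hJ)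
    refine MvPolynomial.totalDegree_finsetSum_le fun i _ => ?_
    exact (MvPolynomial.totalDegree_smul_le ..).trans (MvPolynomial.totalDegree_X_pow ..).le
  have hdvd := char_dvd_card_solutions_of_fintype_sum_lt p hdeg
  let z : {x : J → ZMod p // ∀ k, MvPolynomial.eval x (f k) = 0} :=
    ⟨0, fun k => by simp [f, map_sum, Nat.sub_ne_zero_of_lt hp]⟩
  rw [Fintype.card_eq_nat_card] at hdvd
  have : Nonempty {x : J → ZMod p // ∀ k, MvPolynomial.eval x (f k) = 0} := ⟨z⟩
  have : Nontrivial {x : J → ZMod p // ∀ k, MvPolynomial.eval x (f k) = 0} :=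
    Finite.one_lt_card_iff_nontrivial.1 (hp.trans_le (Nat.le_of_dvd Nat.card_pos hdvd))
  obtain ⟨x, hx⟩ := exists_ne z
  refine ⟨({i | x.1 i ≠ 0} : Finset J).map ⟨(↑), Subtype.val_injective⟩, ?_, ?_, fun k => ?_⟩
  · simp +contextual [Finset.subset_iff]
  · rw [← Subtype.coe_ne_coe, Function.ne_iff] at hx
    obtain ⟨i, hi⟩ := hx
    exact Finset.Nonempty.map ⟨i, by simpa [z] using hi⟩
  · simpa [f, ZMod.pow_card_sub_one, Finset.sum_filter] using x.2 k

/-- Any seven elements of `(ℤ/3ℤ)²` have a nonempty zero-sum subfamily of at most three terms. -/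
lemma exists_nonempty_card_le_three_sum_eq_zero (x : ι → ZMod 3 × ZMod 3) {J : Finset ι}
    (hJ : 7 ≤ J.card) : ∃ T ⊆ J, T.Nonempty ∧ T.card ≤ 3 ∧ ∑ i ∈ T, x i = 0 := by
  classical
  obtain ⟨J₀, hJ₀, hcard⟩ := Finset.exists_subset_card_eq hJ
  obtain ⟨T, hT, hne, hsum⟩ := exists_nonempty_sum_eq_zero_of_mul_lt_card (p := 3)
    ![fun _ => 1, fun i => (x i).1, fun i => (x i).2] (J := J₀) (by simp [hcard])
  have hx : ∑ i ∈ T, x i = 0 := by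
    ext
    · simpa [Prod.fst_sum] using hsum 1
    · simpa [Prod.snd_sum] using hsum 2
  have h3 : 3 ∣ T.card := by
    rw [← ZMod.natCast_eq_zero_iff]
    simpa using hsum 0
  by_cases hle : T.card ≤ 3
  · exact ⟨T, hT.trans hJ₀, hne, hle, hx⟩
  have hT7 : T.card ≤ 7 := hcard ▸ Finset.card_le_card hT
  obtain ⟨i, hi⟩ := hne
  have herase := Finset.card_erase_of_mem hi
  obtain ⟨U, hU, hUne, hUsum⟩ := exists_nonempty_sum_eq_zero_of_mul_lt_card (p := 3)
    ![fun i => (x i).1, fun i => (x i).2] (J := T.erase i) (by omega)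
  have hUx : ∑ i ∈ U, x i = 0 := by
    ext
    · simpa [Prod.fst_sum] using hUsum 0
    · simpa [Prod.snd_sum] using hUsum 1
  have hUT := hU.trans (Finset.erase_subset i T)
  by_cases hU3 : U.card ≤ 3
  · exact ⟨U, hUT.trans (hT.trans hJ₀), hUne, hU3, hUx⟩
  refine ⟨T \ U, Finset.sdiff_subset.trans (hT.trans hJ₀),
    ⟨i, Finset.mem_sdiff.2 ⟨hi, fun h => Finset.notMem_erase i T (hU h)⟩⟩, ?_, ?_⟩
  · rw [Finset.card_sdiff_of_subset hUT]
    omega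
  · rw [Finset.sum_sdiff_eq_sub hUT, hx, hUx, sub_zero]

/-- If a group `G` has a homomorphism to `(ℤ/3ℤ)²` whose kernel has order `q`, then any family of
`3 * q + 2` elements of `G` has a nonempty zero-sum subfamily. -/
lemma exists_nonempty_sum_eq_zero_of_card_ker [Fintype ι] {G : Type*} [AddCommGroup G] [Finite G]
    (π : G →+ ZMod 3 × ZMod 3) (hι : 3 * Nat.card π.ker + 2 ≤ Fintype.card ι) (g : ι → G) :
    ∃ T : Finset ι, T.Nonempty ∧ ∑ i ∈ T, g i = 0 := by
  classical
  set q := Nat.card π.ker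
  have hstep : ∀ T : Finset ι, ∃ T', T.card + 3 ≤ 3 * q → T ⊂ T' ∧
      π (∑ i ∈ T', g i) = π (∑ i ∈ T, g i) ∧ (T.card + 6 ≤ 3 * q → T'.card ≤ T.card + 3) := by
    intro T
    by_cases hT : T.card + 3 ≤ 3 * q
    swap
    · exact ⟨T, fun h => absurd h hT⟩
    have hcompl := Finset.card_compl T
    obtain ⟨U, hU, hne, hcard, hsum⟩ : ∃ U ⊆ Tᶜ, U.Nonempty ∧
        (T.card + 6 ≤ 3 * q → U.card ≤ 3) ∧ ∑ i ∈ U, π (g i) = 0 := by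
      by_cases h6 : T.card + 6 ≤ 3 * q
      · obtain ⟨U, hU, hne, hcard, hsum⟩ :=
          exists_nonempty_card_le_three_sum_eq_zero (fun i => π (g i)) (J := Tᶜ) (by omega)
        exact ⟨U, hU, hne, fun _ => hcard, hsum⟩
      · obtain ⟨U, hU, hne, hsum⟩ := exists_nonempty_sum_eq_zero_of_mul_lt_card (p := 3)
          ![fun i => (π (g i)).1, fun i => (π (g i)).2] (J := Tᶜ) (by omega)
        refine ⟨U, hU, hne, fun h => absurd h h6, ?_⟩
        ext
        · simpa [Prod.fst_sum] using hsum 0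
        · simpa [Prod.snd_sum] using hsum 1
    have hdisj : Disjoint T U :=
      Finset.disjoint_left.2 fun i hi hiU => Finset.mem_compl.1 (hU hiU) hi
    refine ⟨T ∪ U, fun _ => ⟨⟨Finset.subset_union_left, fun h => ?_⟩, ?_, fun h => ?_⟩⟩
    · obtain ⟨i, hi⟩ := hne
      exact Finset.mem_compl.1 (hU hi) (h (Finset.mem_union_right _ hi))
    · rw [Finset.sum_union hdisj, _root_.map_add, map_sum π g U, hsum, add_zero]
    · rw [Finset.card_union_of_disjoint hdisj]
      have := hcard h
      omega
  choose next hnext using hstep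
  let C : ℕ → Finset ι := fun k => next^[k] ∅
  have hC : ∀ k, C (k + 1) = next (C k) := fun k => Function.iterate_succ_apply' _ _ _
  have hCcard : ∀ k < q, (C k).card ≤ 3 * k := by
    intro k
    induction k with
    | zero => simp [C]
    | succ k ih =>
      intro hk
      have h1 := ih (by omega)
      have h2 := (hnext (C k) (by omega)).2.2 (by omega)
      rw [hC]
      omega
  have hCker : ∀ k ≤ q, ∑ i ∈ C k, g i ∈ π.ker := by
    intro k
    induction k with
    | zero => simp [C]
    | succ k ih =>
      intro hk
      have h1 := hCcard k (by omega)
      rw [hC, AddMonoidHom.mem_ker, (hnext (C k) (by omega)).2.1]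
      exact ih (by omega)
  have hCmono : ∀ k l, k < l → l ≤ q → C k ⊂ C l := by
    intro k l hkl
    induction l, hkl using Nat.le_induction with
    | base =>
      intro hk
      have h1 := hCcard k (by omega)
      rw [Nat.succ_eq_add_one, hC]
      exact (hnext (C k) (by omega)).1
    | succ l hkl ih =>
      intro hl
      have h1 := hCcard l (by omega)
      rw [hC]
      exact (ih (by omega)).trans (hnext (C l) (by omega)).1
  let F : Fin (q + 1) → π.ker := fun k => ⟨∑ i ∈ C k, g i, hCker k (by omega)⟩
  have hF : ¬ Function.Injective F := fun hinj => by
    have := Nat.card_le_card_of_injective F hinj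
    simp [q] at this
  obtain ⟨k, l, hkl, hne⟩ : ∃ k l : Fin (q + 1), ∑ i ∈ C k, g i = ∑ i ∈ C l, g i ∧ k < l := by
    rw [Function.not_injective_iff] at hF
    obtain ⟨k, l, hkl, hne⟩ := hF
    have hkl' := congrArg Subtype.val hkl
    rcases lt_or_gt_of_ne hne with h | h
    · exact ⟨k, l, hkl', h⟩
    · exact ⟨l, k, hkl'.symm, h⟩
  have hss := hCmono k l hne (by omega)
  refine ⟨C l \ C k, Finset.sdiff_nonempty.2 hss.2, ?_⟩
  rw [Finset.sum_sdiff_eq_sub hss.1, hkl, sub_self]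

/-- Any `3 * q + 2` elements of `ℤ/3ℤ × ℤ/3qℤ` have a nonempty zero-sum subfamily. -/
lemma exists_nonempty_sum_eq_zero_of_three_mul_add_two_le [Fintype ι] {q : ℕ} (hq : q ≠ 0)
    (hι : 3 * q + 2 ≤ Fintype.card ι) (g : ι → ZMod 3 × ZMod (3 * q)) :
    ∃ T : Finset ι, T.Nonempty ∧ ∑ i ∈ T, g i = 0 := by
  have : NeZero (3 * q) := ⟨by omega⟩
  let π : ZMod 3 × ZMod (3 * q) →+ ZMod 3 × ZMod 3 :=
    (AddMonoidHom.id _).prodMap (ZMod.castHom (Dvd.intro q rfl : 3 ∣ 3 * q) (ZMod 3)).toAddMonoidHom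
  have hπ : Function.Surjective π :=
    Function.surjective_id.prodMap (ZMod.castHom_surjective (Dvd.intro q rfl : 3 ∣ 3 * q))
  refine exists_nonempty_sum_eq_zero_of_card_ker π (hι.trans' ?_) g
  have h1 := AddSubgroup.card_mul_index π.ker
  rw [AddSubgroup.index_ker, AddMonoidHom.range_eq_top.2 hπ, AddSubgroup.card_top] at h1
  simp only [Nat.card_prod, Nat.card_zmod] at h1
  omega

end ZeroSums

open scoped Classical in
/-- Lemma 6(ii): for a prime q ≥ 5, G = (ℤ/3ℤ) × (ℤ/3qℤ), and a regular sequence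
S = g₁ ⋯ g_ℓ of length ℓ = 3q+3 over G: if there are a subsequence S' (with index set I'),
a nontrivial subgroup H' and a ∈ G with Σ₀(S') ⊇ a + H', and, with
M = st((a + H') + Σ₀(S S'⁻¹)), one has (ℓ - |I_{S_M} ∪ I_{S'}| + 1)·|M| ≥ 9q,
then Σ(S) = G. -/
theorem basis_of_kneser_bound (q : ℕ) (hq : q.Prime) (hq5 : 5 ≤ q)
    (g : Fin (3 * q + 3) → ZMod 3 × ZMod (3 * q))
    (hreg : IsRegularSeq (Finset.univ.val.map g))
    (I' : Finset (Fin (3 * q + 3)))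
    (H' : AddSubgroup (ZMod 3 × ZMod (3 * q))) (hH' : H' ≠ ⊥)
    (a : ZMod 3 × ZMod (3 * q))
    (hcoset : a +ᵥ (H' : Set (ZMod 3 × ZMod (3 * q)))
        ⊆ insert 0 (subSums (I'.val.map g)))
    (A : Set (ZMod 3 × ZMod (3 * q)))
    (hA : A = (a +ᵥ (H' : Set (ZMod 3 × ZMod (3 * q))))
        + insert 0 (subSums ((I'ᶜ).val.map g)))
    (M : AddSubgroup (ZMod 3 × ZMod (3 * q)))
    (hM : (M : Set (ZMod 3 × ZMod (3 * q))) = {x | x +ᵥ A = A})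
    (hbound : (3 * q + 3 - ((Finset.univ.filter (fun i => g i ∈ M)) ∪ I').card + 1)
        * Nat.card M ≥ 9 * q) :
    subSums (Finset.univ.val.map g) = Set.univ := by
  have : NeZero (3 * q) := ⟨by omega⟩
  rw [insert_zero_subSums] at hA hcoset
  have hAuniv : A = Set.univ := by
    refine eq_univ_of_card_le_card_filter_mul_card hA hM ?_
    have hcompl : (I'ᶜ).filter (fun i => g i ∉ M) =
        (Finset.univ.filter (fun i => g i ∈ M) ∪ I')ᶜ := by
      ext i
      simp [and_comm]
    rw [hcompl, Finset.card_compl, Fintype.card_fin, Nat.card_prod, Nat.card_zmod, Nat.card_zmod]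
    exact hbound.trans' (by omega)
  ext x
  refine ⟨fun _ => trivial, fun _ => ?_⟩
  have hx : x ∈ A := hAuniv ▸ Set.mem_univ x
  rw [hA] at hx
  obtain ⟨y, hy, _, ⟨V, hV, rfl⟩, rfl⟩ := hx
  obtain ⟨U, hU, rfl⟩ := hcoset hy
  have hdisj : Disjoint U V :=
    Finset.disjoint_left.2 fun i hi hiV => Finset.mem_compl.1 (hV hiV) (hU hi)
  change ∑ i ∈ U, g i + ∑ i ∈ V, g i ∈ _
  rw [← Finset.sum_union hdisj]
  rcases (U ∪ V).eq_empty_or_nonempty with h0 | hne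
  · obtain ⟨T, hT, hsum⟩ := exists_nonempty_sum_eq_zero_of_three_mul_add_two_le
      (by omega) (by simp) g
    rw [h0, Finset.sum_empty, ← hsum]
    exact sum_mem_subSums hT (Finset.subset_univ T)
  · exact sum_mem_subSums hne (Finset.subset_univ _)
end

section
/- Let q ≥ 5 be a prime number, let G = C_3 ⊕ C_{3q} (concretely, G = (ℤ/3ℤ) × (ℤ/3qℤ)), and write G = H ⊕ K where H is the subgroup of elements of order dividing 3 (so H ≅ C_3 ⊕ C_3) and K is the unique subgroup of order q. Let F be a splitting field of G, i.e., a field whose characteristic does not divide 3q and which contains a primitive 3q-th root of unity. Let S = g_1 · … · g_ℓ be a regular sequence over G of length ℓ = 3q + 3, and let I_{S_H} and I_{S_K} be the index sets of the terms of S lying in H and in K, respectively. If there exist nonzero scalars b_i ∈ F^× for all i ∈ I_{S_H} ∪ I_{S_K} such that the product ∏_{i ∈ I_{S_H} ∪ I_{S_K}} (X^{g_i} − b_i) equals 0 in the group algebra FG, then Σ(S) = G. -/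
open Multiset

open scoped Pointwise in
lemma min_le_card_subsums_image {p : ℕ} [Fact p.Prime] {ι : Type*} [DecidableEq ι]
    (k : ι → ZMod p) (Z : Finset ι) (hk : ∀ i ∈ Z, k i ≠ 0) :
    min p (Z.card + 1) ≤ (Z.powerset.image fun J => ∑ i ∈ J, k i).card := by
  induction Z using Finset.induction_on with
  | empty => simp
  | insert a Z ha ih =>
    have ih' := ih fun i hi => hk i (Finset.mem_insert_of_mem hi)
    set A := Z.powerset.image fun J => ∑ i ∈ J, k i with hA
    have hsub : ({0, k a} : Finset (ZMod p)) + A ⊆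
        (insert a Z).powerset.image fun J => ∑ i ∈ J, k i := by
      intro x hx
      obtain ⟨y, hy, z, hz, rfl⟩ := Finset.mem_add.1 hx
      obtain ⟨J, hJ, rfl⟩ := Finset.mem_image.1 hz
      rw [Finset.mem_powerset] at hJ
      rcases Finset.mem_insert.1 hy with rfl | hy
      · exact Finset.mem_image.2 ⟨J, Finset.mem_powerset.2
          (hJ.trans (Finset.subset_insert a Z)), by simp⟩
      · rw [Finset.mem_singleton] at hy
        subst hy
        exact Finset.mem_image.2 ⟨insert a J, Finset.mem_powerset.2
          (Finset.insert_subset_insert a hJ),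
          Finset.sum_insert fun h => ha (hJ h)⟩
    have hcd := ZMod.cauchy_davenport (Fact.out : p.Prime)
      (s := ({0, k a} : Finset (ZMod p))) (t := A) (by simp)
      ⟨0, Finset.mem_image.2 ⟨∅, by simp, by simp⟩⟩
    rw [Finset.card_pair (hk a (Finset.mem_insert_self a Z)).symm] at hcd
    have := Finset.card_le_card hsub
    rw [Finset.card_insert_of_notMem ha]
    omega

lemma exists_subset_sum_eq {p : ℕ} [Fact p.Prime] {ι : Type*} [DecidableEq ι]
    (k : ι → ZMod p) (Z : Finset ι) (hk : ∀ i ∈ Z, k i ≠ 0) (hZ : p ≤ Z.card + 1)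
    (v : ZMod p) : ∃ J ⊆ Z, ∑ i ∈ J, k i = v := by
  have h := min_le_card_subsums_image k Z hk
  rw [min_eq_left hZ] at h
  have : (Z.powerset.image fun J => ∑ i ∈ J, k i) = Finset.univ :=
    Finset.eq_univ_of_card _ (le_antisymm (Finset.card_le_univ _) (by simpa [ZMod.card] using h))
  have hv := Finset.mem_univ v
  rw [← this] at hv
  simpa using hv

lemma exists_subset_sums_eq_ne {p : ℕ} [Fact p.Prime] {ι A : Type*} [DecidableEq ι]
    [AddCommGroup A] (k : ι → ZMod p) (h : ι → A) (Z : Finset ι) (hk : ∀ i ∈ Z, k i ≠ 0)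
    (hZ : p ≤ Z.card + 1) (t : ι) (ht : t ∉ Z) (hpt : p • h t ≠ 0) :
    ∃ J ⊆ insert t Z, ∃ J' ⊆ insert t Z,
      ∑ i ∈ J, k i = ∑ i ∈ J', k i ∧ ∑ i ∈ J, h i ≠ ∑ i ∈ J', h i := by
  by_contra! hcon
  choose J hJ hJk using exists_subset_sum_eq k Z hk hZ
  have hstep (v : ZMod p) : ∑ i ∈ J (k t + v), h i = h t + ∑ i ∈ J v, h i := by
    have htv : t ∉ J v := fun hh => ht (hJ v hh)
    rw [← Finset.sum_insert htv]
    refine hcon _ ((hJ _).trans (Finset.subset_insert _ _)) _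
      (Finset.insert_subset_insert _ (hJ v)) ?_
    rw [Finset.sum_insert htv, hJk, hJk]
  have hiter (n : ℕ) : ∑ i ∈ J (n • k t), h i = n • h t + ∑ i ∈ J 0, h i := by
    induction n with
    | zero => simp
    | succ n ih => rw [succ_nsmul', hstep, ih, succ_nsmul', add_assoc]
  have := hiter p
  exact hpt (by simpa using this)

lemma two_le_card_of_forall_mem : ∀ A B C : Finset (ZMod 3),
    A.card ≤ 2 → B.card ≤ 2 → C.card ≤ 2 → (∀ s t, s ∈ A ∨ t ∈ B ∨ -s - t ∈ C) →
    2 ≤ A.card ∧ 2 ≤ B.card ∨ 2 ≤ A.card ∧ 2 ≤ C.card ∨ 2 ≤ B.card ∧ 2 ≤ C.card := by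
  decide

/-- The affine plane over `ZMod 3`, identified with its own dual through `Plane.dot`. -/
abbrev Plane := ZMod 3 × ZMod 3

/-- The standard bilinear form on the plane over `ZMod 3`. -/
def Plane.dot (u v : Plane) : ZMod 3 := u.1 * v.1 + u.2 * v.2

lemma Plane.dot_neg (u v : Plane) : u.dot (-v) = -u.dot v := by
  simp [Plane.dot]; ring

set_option synthInstance.maxSize 1000 in
set_option synthInstance.maxHeartbeats 200000 in
lemma Plane.exists_independent : ∀ a : Plane, a ≠ 0 → ∃ b : Plane, b ≠ 0 ∧
    (b + a ≠ 0 ∧ b - a ≠ 0) ∧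
    (b + a ≠ b ∧ b + a ≠ -b) ∧ (b - a ≠ b ∧ b - a ≠ -b) ∧ (b - a ≠ b + a ∧ b - a ≠ -(b + a)) ∧
    (∀ x : Plane, x ≠ 0 → (x = a ∨ x = -a) ∨ (x = b ∨ x = -b) ∨ (x = b + a ∨ x = -(b + a)) ∨
      (x = b - a ∨ x = -(b - a))) ∧
    ∀ s t, ∃ u : Plane, u.dot b = s ∧ u.dot (b + a) = t := by
  decide +kernel

lemma Plane.dot_sub_eq (u a b : Plane) : u.dot (b - a) = -u.dot b - u.dot (b + a) := by
  have h3 : (3 : ZMod 3) = 0 := rfl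
  simp only [Plane.dot, Prod.fst_sub, Prod.snd_sub, Prod.fst_add, Prod.snd_add]
  linear_combination (u.1 * b.1 + u.2 * b.2) * h3

lemma Plane.directions_of_cover {ι : Type*} (I : Finset ι) (h : ι → Plane) (c : ι → ZMod 3)
    (h0 : ∀ i ∈ I, h i ≠ 0)
    (h2 : ∀ a : Plane, a ≠ 0 → (I.filter fun i => h i = a ∨ h i = -a).card ≤ 2)
    (hc : ∀ u : Plane, ∃ i ∈ I, u.dot (h i) = c i) :
    (∀ a : Plane, a ≠ 0 → ∃ i ∈ I, h i = a ∨ h i = -a) ∨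
    ∃ a b : Plane, a ≠ 0 ∧ b ≠ 0 ∧ b ≠ a ∧ b ≠ -a ∧
      2 ≤ (I.filter fun i => h i = a ∨ h i = -a).card ∧
      2 ≤ (I.filter fun i => h i = b ∨ h i = -b).card := by
  rw [or_iff_not_imp_left]
  intro hne
  push Not at hne
  obtain ⟨a, ha, hna⟩ := hne
  obtain ⟨b, hb, ⟨hba, hbs⟩, h1, h3, h4, hdir, hu⟩ := Plane.exists_independent a ha
  let N : Plane → Finset ι := fun d => I.filter fun i => h i = d ∨ h i = -d
  let L : Plane → Finset (ZMod 3) := fun d => (N d).image fun i => if h i = d then c i else -c i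
  have hLN (d : Plane) : (L d).card ≤ (N d).card := Finset.card_image_le
  have hmem (u d : Plane) (i : ι) (hi : i ∈ I) (hic : u.dot (h i) = c i)
      (hd : h i = d ∨ h i = -d) : u.dot d ∈ L d := by
    refine Finset.mem_image.2 ⟨i, Finset.mem_filter.2 ⟨hi, hd⟩, ?_⟩
    split_ifs with hid
    · rw [← hic, hid]
    · rw [← hic, hd.resolve_left hid, Plane.dot_neg, neg_neg]
  have key := two_le_card_of_forall_mem (L b) (L (b + a)) (L (b - a))
    ((hLN _).trans (h2 _ hb)) ((hLN _).trans (h2 _ hba)) ((hLN _).trans (h2 _ hbs)) (by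
      intro s t
      obtain ⟨u, rfl, rfl⟩ := hu s t
      obtain ⟨i, hi, hic⟩ := hc u
      rw [← Plane.dot_sub_eq]
      rcases hdir (h i) (h0 i hi) with hd | hd | hd | hd
      · exact absurd hd (not_or.2 (hna i hi))
      · exact Or.inl (hmem u _ i hi hic hd)
      · exact Or.inr (Or.inl (hmem u _ i hi hic hd))
      · exact Or.inr (Or.inr (hmem u _ i hi hic hd)))
  rcases key with ⟨hA, hB⟩ | ⟨hA, hB⟩ | ⟨hA, hB⟩
  · exact ⟨_, _, hb, hba, h1.1, h1.2, hA.trans (hLN _), hB.trans (hLN _)⟩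
  · exact ⟨_, _, hb, hbs, h3.1, h3.2, hA.trans (hLN _), hB.trans (hLN _)⟩
  · exact ⟨_, _, hba, hbs, h4.1, h4.2, hA.trans (hLN _), hB.trans (hLN _)⟩

lemma exists_subset_insert_sum {ι A : Type*} [DecidableEq ι] [AddCommMonoid A] (h : ι → A)
    {I : Finset ι} {i : ι} (hi : i ∉ I) {x : A} (hx : ∃ J ⊆ I, ∑ j ∈ J, h j = x) (m : Fin 2) :
    ∃ J ⊆ insert i I, ∑ j ∈ J, h j = m.val • h i + x := by
  obtain ⟨J, hJ, rfl⟩ := hx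
  fin_cases m
  · exact ⟨J, hJ.trans (Finset.subset_insert _ _), by simp⟩
  · exact ⟨insert i J, Finset.insert_subset_insert _ hJ,
      by rw [Finset.sum_insert fun h => hi (hJ h)]; simp⟩

lemma exists_subset_four_sum {ι A : Type*} [DecidableEq ι] [AddCommMonoid A] (h : ι → A)
    {I : Finset ι} {i j k l : ι} (hi : i ∈ I) (hj : j ∈ I) (hk : k ∈ I) (hl : l ∈ I)
    (hij : i ≠ j) (hik : i ≠ k) (hil : i ≠ l) (hjk : j ≠ k) (hjl : j ≠ l) (hkl : k ≠ l)
    (m n r s : Fin 2) :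
    ∃ J ⊆ I, ∑ x ∈ J, h x = m.val • h i + (n.val • h j + (r.val • h k + (s.val • h l + 0))) := by
  obtain ⟨J, hJ, hs⟩ := exists_subset_insert_sum h (i := i) (I := {j, k, l}) (by simp [*])
    (exists_subset_insert_sum h (i := j) (I := {k, l}) (by simp [*])
      (exists_subset_insert_sum h (i := k) (I := {l}) (by simp [*])
        (exists_subset_insert_sum h (i := l) (I := ∅) (by simp)
          ⟨∅, subset_rfl, Finset.sum_empty⟩ s) r) n) m
  refine ⟨J, hJ.trans ?_, hs⟩
  intro x hx
  simp only [Finset.mem_insert, Finset.mem_singleton] at hx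
  rcases hx with rfl | rfl | rfl | rfl <;> assumption

lemma Plane.exists_pair_sum_eq_smul : ∀ a : Plane, ∀ e₁ e₂ : Fin 2, ∀ t : Fin 3, ∃ m n : Fin 2,
    m.val • (if e₁ = 0 then a else -a) + n.val • (if e₂ = 0 then a else -a) = t.val • a := by
  decide +kernel

lemma Plane.exists_smul_add_smul : ∀ a b : Plane, a ≠ 0 → b ≠ 0 → b ≠ a → b ≠ -a →
    ∀ x : Plane, ∃ s t : Fin 3, s.val • a + t.val • b = x := by
  decide +kernel

lemma Plane.exists_sum_of_pairs (a b : Plane) (ha : a ≠ 0) (hb : b ≠ 0) (hba : b ≠ a)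
    (hba' : b ≠ -a) (e₁ e₂ e₃ e₄ : Fin 2) (x : Plane) : ∃ m n r s : Fin 2,
    m.val • (if e₁ = 0 then a else -a) + (n.val • (if e₂ = 0 then a else -a) +
     (r.val • (if e₃ = 0 then b else -b) + (s.val • (if e₄ = 0 then b else -b) + 0))) = x := by
  obtain ⟨t, u, rfl⟩ := Plane.exists_smul_add_smul a b ha hb hba hba' x
  obtain ⟨m, n, hmn⟩ := Plane.exists_pair_sum_eq_smul a e₁ e₂ t
  obtain ⟨r, s, hrs⟩ := Plane.exists_pair_sum_eq_smul b e₃ e₄ u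
  exact ⟨m, n, r, s, by rw [← hmn, ← hrs, add_zero, add_assoc]⟩

lemma Plane.exists_sum_of_standard_directions : ∀ x y : Plane, x ≠ y →
    ∃ m n r s : Fin 2, m.val • (1, 0) + (n.val • (0, 1) + (r.val • (1, 1) + s.val • (1, 2))) = x ∨
      m.val • (1, 0) + (n.val • (0, 1) + (r.val • (1, 1) + s.val • (1, 2))) = y := by
  decide +kernel

lemma exists_smul_sign_eq {A : Type*} [AddCommGroup A] (a : A) (e m : Fin 2) :
    ∃ n : Fin 2, n.val • (if e = 0 then a else -a) = m.val • a - if e = 0 then 0 else a := by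
  fin_cases e
  · exact ⟨m, by simp⟩
  · fin_cases m
    · exact ⟨1, by simp⟩
    · exact ⟨0, by simp⟩

lemma Plane.exists_sum_of_directions (e₁ e₂ e₃ e₄ : Fin 2) (x y : Plane) (hxy : x ≠ y) :
    ∃ m n r s : Fin 2, ∃ z, (z = x ∨ z = y) ∧
    m.val • (if e₁ = 0 then (1, 0) else -(1, 0) : Plane) +
     (n.val • (if e₂ = 0 then (0, 1) else -(0, 1) : Plane) +
     (r.val • (if e₃ = 0 then (1, 1) else -(1, 1) : Plane) +
     (s.val • (if e₄ = 0 then (1, 2) else -(1, 2) : Plane) + 0))) = z := by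
  let w : Plane := (if e₁ = 0 then 0 else (1, 0)) + ((if e₂ = 0 then 0 else (0, 1)) +
    ((if e₃ = 0 then 0 else (1, 1)) + (if e₄ = 0 then 0 else (1, 2))))
  obtain ⟨m, n, r, s, hs⟩ := Plane.exists_sum_of_standard_directions (x + w) (y + w)
    fun h => hxy (add_right_cancel h)
  obtain ⟨m', hm⟩ := exists_smul_sign_eq ((1, 0) : Plane) e₁ m
  obtain ⟨n', hn⟩ := exists_smul_sign_eq ((0, 1) : Plane) e₂ n
  obtain ⟨r', hr⟩ := exists_smul_sign_eq ((1, 1) : Plane) e₃ r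
  obtain ⟨s', hs'⟩ := exists_smul_sign_eq ((1, 2) : Plane) e₄ s
  refine ⟨m', n', r', s', _, ?_, rfl⟩
  rw [hm, hn, hr, hs']
  refine hs.imp (fun h => ?_) fun h => ?_ <;>
  · rw [← sub_eq_iff_eq_add] at h
    rw [← h]
    simp only [w]
    abel

lemma exists_sign {A : Type*} [AddCommGroup A] {x a : A} (hx : x = a ∨ x = -a) :
    ∃ e : Fin 2, x = if e = 0 then a else -a := by
  rcases hx with rfl | rfl
  · exact ⟨0, by simp⟩
  · exact ⟨1, by simp⟩

lemma ne_of_eq_or_eq_neg {ι A : Type*} [AddCommGroup A] (h : ι → A) {i j : ι} {a b : A}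
    (hi : h i = a ∨ h i = -a) (hj : h j = b ∨ h j = -b) (hba : b ≠ a) (hba' : b ≠ -a) :
    i ≠ j := by
  rintro rfl
  rcases hi with hi | hi <;> rcases hj with hj | hj
  · exact hba (hj.symm.trans hi)
  · exact hba' (by rw [← hi, hj, neg_neg])
  · exact hba' (hj.symm.trans hi)
  · exact hba (neg_injective (hj.symm.trans hi))

/-- If affine lines with normal vectors `h i`, at most two in each direction, cover the plane
over `ZMod 3`, then the subset sums of `h` miss at most one point. -/
lemma Plane.exists_subset_sum_of_cover {ι : Type*} [DecidableEq ι] (I : Finset ι) (h : ι → Plane)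
    (c : ι → ZMod 3) (h0 : ∀ i ∈ I, h i ≠ 0)
    (h2 : ∀ a : Plane, a ≠ 0 → (I.filter fun i => h i = a ∨ h i = -a).card ≤ 2)
    (hc : ∀ u : Plane, ∃ i ∈ I, u.dot (h i) = c i) (x y : Plane) (hxy : x ≠ y) :
    ∃ J ⊆ I, ∑ j ∈ J, h j = x ∨ ∑ j ∈ J, h j = y := by
  rcases Plane.directions_of_cover I h c h0 h2 hc with hd | ⟨a, b, ha, hb, hba, hba', hA, hB⟩
  · obtain ⟨i, hi, hid⟩ := hd (1, 0) (by decide)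
    obtain ⟨j, hj, hjd⟩ := hd (0, 1) (by decide)
    obtain ⟨k, hk, hkd⟩ := hd (1, 1) (by decide)
    obtain ⟨l, hl, hld⟩ := hd (1, 2) (by decide)
    obtain ⟨e₁, he₁⟩ := exists_sign hid
    obtain ⟨e₂, he₂⟩ := exists_sign hjd
    obtain ⟨e₃, he₃⟩ := exists_sign hkd
    obtain ⟨e₄, he₄⟩ := exists_sign hld
    obtain ⟨m, n, r, s, z, hz, hsum⟩ := Plane.exists_sum_of_directions e₁ e₂ e₃ e₄ x y hxy
    rw [← he₁, ← he₂, ← he₃, ← he₄] at hsum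
    obtain ⟨J, hJ, hJs⟩ := exists_subset_four_sum h hi hj hk hl
      (ne_of_eq_or_eq_neg h hid hjd (by decide) (by decide))
      (ne_of_eq_or_eq_neg h hid hkd (by decide) (by decide))
      (ne_of_eq_or_eq_neg h hid hld (by decide) (by decide))
      (ne_of_eq_or_eq_neg h hjd hkd (by decide) (by decide))
      (ne_of_eq_or_eq_neg h hjd hld (by decide) (by decide))
      (ne_of_eq_or_eq_neg h hkd hld (by decide) (by decide)) m n r s
    exact ⟨J, hJ, by rwa [hJs, hsum]⟩
  · obtain ⟨i, hi, j, hj, hij⟩ := Finset.one_lt_card.1 hA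
    obtain ⟨k, hk, l, hl, hkl⟩ := Finset.one_lt_card.1 hB
    rw [Finset.mem_filter] at hi hj hk hl
    obtain ⟨e₁, he₁⟩ := exists_sign hi.2
    obtain ⟨e₂, he₂⟩ := exists_sign hj.2
    obtain ⟨e₃, he₃⟩ := exists_sign hk.2
    obtain ⟨e₄, he₄⟩ := exists_sign hl.2
    obtain ⟨m, n, r, s, hsum⟩ := Plane.exists_sum_of_pairs a b ha hb hba hba' e₁ e₂ e₃ e₄ x
    rw [← he₁, ← he₂, ← he₃, ← he₄] at hsum
    obtain ⟨J, hJ, hJs⟩ := exists_subset_four_sum h hi.1 hj.1 hk.1 hl.1 hij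
      (ne_of_eq_or_eq_neg h hi.2 hk.2 hba hba') (ne_of_eq_or_eq_neg h hi.2 hl.2 hba hba')
      (ne_of_eq_or_eq_neg h hj.2 hk.2 hba hba') (ne_of_eq_or_eq_neg h hj.2 hl.2 hba hba')
      hkl m n r s
    exact ⟨J, hJ, Or.inl (hJs.trans hsum)⟩

lemma exists_nonempty_subset_sum_eq {q : ℕ} [Fact q.Prime] (hq5 : 5 ≤ q) {ι : Type*} [Fintype ι]
    [DecidableEq ι] (hι : Fintype.card ι = 3 * q + 3) (h : ι → Plane) (k : ι → ZMod q)
    (hH : (Finset.univ.filter fun i => k i = 0).card ≤ 8)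
    (hK : (Finset.univ.filter fun i => h i = 0).card ≤ q - 1)
    (hsum : ∀ x y : Plane, x ≠ y → ∃ J ⊆ Finset.univ.filter fun i => k i = 0,
      ∑ j ∈ J, h j = x ∨ ∑ j ∈ J, h j = y) (x : Plane) (v : ZMod q) :
    ∃ J : Finset ι, J.Nonempty ∧ ∑ j ∈ J, h j = x ∧ ∑ j ∈ J, k j = v := by
  set I := Finset.univ.filter fun i => k i = 0 with hI
  have hT : 3 * q - 5 ≤ Iᶜ.card := by rw [Finset.card_compl, hι]; omega
  have hkT (i : ι) (hi : i ∈ Iᶜ) : k i ≠ 0 := by simpa [hI] using hi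
  obtain ⟨t₀, ht₀⟩ : Iᶜ.Nonempty := Finset.card_pos.1 (by omega)
  obtain ⟨Z, hZ, hZc⟩ := Finset.exists_subset_card_eq (s := Iᶜ.erase t₀) (n := q - 1)
    (by rw [Finset.card_erase_of_mem ht₀]; omega)
  have hZ' : Z ⊆ Iᶜ := hZ.trans (Finset.erase_subset _ _)
  have hRc : 2 * q - 5 ≤ (Iᶜ.erase t₀ \ Z).card := by
    rw [Finset.card_sdiff_of_subset hZ, Finset.card_erase_of_mem ht₀]; omega
  obtain ⟨t, ht, htn⟩ := Finset.exists_mem_notMem_of_card_lt_card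
    (s := Finset.univ.filter fun i => h i = 0) (t := Iᶜ.erase t₀ \ Z) (by omega)
  have htZ : t ∉ Z := (Finset.mem_sdiff.1 ht).2
  have hht : h t ≠ 0 := by simpa using htn
  have hqt : q • h t ≠ 0 := by
    intro h0
    have h3 : 3 • h t = 0 := by
      ext <;> simp <;> exact Or.inl rfl
    have hcop : Nat.Coprime q 3 := (Nat.coprime_primes Fact.out Nat.prime_three).2 (by omega)
    have h1 := Nat.dvd_gcd (addOrderOf_dvd_of_nsmul_eq_zero h0)
      (addOrderOf_dvd_of_nsmul_eq_zero h3)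
    rw [hcop.gcd_eq_one, Nat.dvd_one, AddMonoid.addOrderOf_eq_one_iff] at h1
    exact hht h1
  obtain ⟨J, hJ, J', hJ', hJk, hJh⟩ := exists_subset_sums_eq_ne k h Z (fun i hi => hkT i (hZ' hi))
    (by omega) t htZ hqt
  obtain ⟨R, hR, hRk⟩ := exists_subset_sum_eq k ((Iᶜ.erase t₀ \ Z).erase t)
    (fun i hi => hkT i (by simp only [Finset.mem_erase, Finset.mem_sdiff] at hi; tauto))
    (by rw [Finset.card_erase_of_mem ht]; omega) (v - k t₀ - ∑ j ∈ J, k j)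
  have hmem (i : ι) (hi : i ∈ insert t Z) : i ∈ Iᶜ ∧ i ≠ t₀ := by
    rcases Finset.mem_insert.1 hi with rfl | hi
    · simp only [Finset.mem_erase, Finset.mem_sdiff] at ht; tauto
    · exact ⟨hZ' hi, Finset.ne_of_mem_erase (hZ hi)⟩
  have hglue (L : Finset ι) (hL : L ⊆ insert t Z) (M : Finset ι) (hM : M ⊆ I)
      {A : Type} [AddCommMonoid A] (f : ι → A) :
      ∑ j ∈ insert t₀ (M ∪ (R ∪ L)), f j
        = f t₀ + (∑ j ∈ M, f j + (∑ j ∈ R, f j + ∑ j ∈ L, f j)) := by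
    rw [Finset.sum_insert, Finset.sum_union, Finset.sum_union]
    · rw [Finset.disjoint_left]
      intro i hi hi'
      have h1 := hR hi
      have h2 := hL hi'
      simp only [Finset.mem_erase, Finset.mem_sdiff, Finset.mem_insert] at h1 h2
      tauto
    · rw [Finset.disjoint_left]
      intro i hi hi'
      have h1 := hM hi
      rcases Finset.mem_union.1 hi' with h2 | h2
      · have h3 := hR h2
        simp only [Finset.mem_erase, Finset.mem_sdiff, Finset.mem_compl] at h3
        tauto
      · exact Finset.mem_compl.1 (hmem i (hL h2)).1 h1
    · intro hi
      rw [Finset.mem_union, Finset.mem_union] at hi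
      rcases hi with h1 | h1 | h1
      · exact Finset.mem_compl.1 ht₀ (hM h1)
      · have h3 := hR h1
        simp at h3
      · exact (hmem _ (hL h1)).2 rfl
  have hMk (M : Finset ι) (hM : M ⊆ I) : ∑ j ∈ M, k j = 0 :=
    Finset.sum_eq_zero fun i hi => (Finset.mem_filter.1 (hM hi)).2
  obtain ⟨M, hM, hMs⟩ := hsum (x - h t₀ - ∑ j ∈ R, h j - ∑ j ∈ J, h j)
    (x - h t₀ - ∑ j ∈ R, h j - ∑ j ∈ J', h j) fun he => hJh (sub_right_injective he)
  rcases hMs with hMs | hMs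
  · refine ⟨insert t₀ (M ∪ (R ∪ J)), Finset.insert_nonempty _ _, ?_, ?_⟩
    · rw [hglue J hJ M hM, hMs]; abel
    · rw [hglue J hJ M hM, hMk M hM, hRk]; abel
  · refine ⟨insert t₀ (M ∪ (R ∪ J')), Finset.insert_nonempty _ _, ?_, ?_⟩
    · rw [hglue J' hJ' M hM, hMs]; abel
    · rw [hglue J' hJ' M hM, hMk M hM, hRk, hJk]; abel

lemma IsPrimitiveRoot.zmodChar_injective {F : Type*} [CommMonoid F] {n : ℕ} [NeZero n] {ζ : F}
    (hζ : IsPrimitiveRoot ζ n) : Function.Injective (AddChar.zmodChar n hζ.pow_eq_one) := by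
  intro a b hab
  rw [AddChar.zmodChar_apply, AddChar.zmodChar_apply] at hab
  exact ZMod.val_injective n (hζ.pow_inj (ZMod.val_lt a) (ZMod.val_lt b) hab)

lemma exists_forall_char_mul_ne {q : ℕ} [Fact q.Prime] {F ι : Type*} [CommMonoid F]
    (ψ : AddChar (ZMod q) F) (hψ : Function.Injective ψ) (I : Finset ι) (hI : I.card < q)
    (k : ι → ZMod q) (hk : ∀ i ∈ I, k i ≠ 0) (b : ι → F) :
    ∃ v, ∀ i ∈ I, ψ (v * k i) ≠ b i := by
  classical
  by_contra! hcon
  choose f hfI hf using hcon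
  have hinj : Function.Injective f := by
    intro v w hvw
    have h1 := (hf v).trans (hvw ▸ (hf w).symm)
    rw [hvw] at h1
    exact mul_right_cancel₀ (hk _ (hfI w)) (hψ h1)
  have := Finset.card_le_card_of_injOn (s := Finset.univ) f (fun v _ => hfI v) hinj.injOn
  rw [Finset.card_univ, ZMod.card] at this
  omega

/-- The characters of `(ZMod 3)² × ZMod q` given by a character of each of the two coordinates. -/
def Plane.prodChar {F : Type*} [CommMonoid F] {q : ℕ} (ω : AddChar (ZMod 3) F)
    (η : AddChar (ZMod q) F) (u : Plane) (v : ZMod q) : Multiplicative (Plane × ZMod q) →* F where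
  toFun x := ω (u.dot x.toAdd.1) * η (v * x.toAdd.2)
  map_one' := by simp [Plane.dot]
  map_mul' x y := by
    have h1 : u.dot (x.toAdd.1 + y.toAdd.1) = u.dot x.toAdd.1 + u.dot y.toAdd.1 := by
      simp only [Plane.dot, Prod.fst_add, Prod.snd_add]; ring
    rw [toAdd_mul, Prod.fst_add, Prod.snd_add, h1, mul_add, AddChar.map_add_eq_mul,
      AddChar.map_add_eq_mul]
    exact mul_mul_mul_comm _ _ _ _

lemma exists_dot_cover {q : ℕ} [Fact q.Prime] {F ι : Type*} [CommMonoid F]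
    {ω : AddChar (ZMod 3) F} (hω : Function.Injective ω)
    {η : AddChar (ZMod q) F} (hη : Function.Injective η) (IH IK : Finset ι) (hIK : IK.card < q)
    (h : ι → Plane) (k : ι → ZMod q) (hk0 : ∀ i ∈ IH, k i = 0) (hh0 : ∀ i ∈ IK, h i = 0)
    (hk : ∀ i ∈ IK, k i ≠ 0) (b : ι → F)
    (hcov : ∀ χ : Multiplicative (Plane × ZMod q) →* F,
      ∃ i, (i ∈ IH ∨ i ∈ IK) ∧ χ (Multiplicative.ofAdd (h i, k i)) = b i) :
    ∃ c : ι → ZMod 3, ∀ u : Plane, ∃ i ∈ IH, u.dot (h i) = c i := by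
  classical
  obtain ⟨v, hv⟩ := exists_forall_char_mul_ne η hη IK hIK k hk b
  refine ⟨fun i => if hi : ∃ s, ω s = b i then hi.choose else 0, fun u => ?_⟩
  obtain ⟨i, hi, hχ⟩ := hcov (Plane.prodChar ω η u v)
  change ω (u.dot (h i)) * η (v * k i) = b i at hχ
  rcases hi with hi | hi
  · rw [hk0 i hi, mul_zero, AddChar.map_zero_eq_one, mul_one] at hχ
    have hex : ∃ s, ω s = b i := ⟨_, hχ⟩
    refine ⟨i, hi, hω ?_⟩
    simp only [dif_pos hex]
    rw [hχ, hex.choose_spec]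
  · have h1 : u.dot (h i) = 0 := by simp [hh0 i hi, Plane.dot]
    rw [h1, AddChar.map_zero_eq_one, one_mul] at hχ
    exact absurd hχ (hv i hi)

lemma IsRegularSeq.card_filter_le {ι A B : Type*} [Fintype ι] [AddCommGroup A] [AddCommGroup B]
    (e : A ≃+ B) {g : ι → A} (hreg : IsRegularSeq (Finset.univ.val.map g))
    (C : AddSubgroup B) (hC : C ≠ ⊤) (p : ι → Prop) [DecidablePred p]
    (hp : ∀ i, p i → e (g i) ∈ C) : (Finset.univ.filter p).card ≤ Nat.card C - 1 := by
  classical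
  have hC' : C.comap (e : A →+ B) ≠ ⊤ := by
    intro htop
    refine hC ((AddSubgroup.eq_top_iff' C).2 fun y => ?_)
    have : e.symm y ∈ C.comap (e : A →+ B) := htop ▸ AddSubgroup.mem_top _
    simpa using this
  have h := hreg _ hC'
  rw [Multiset.filter_map, Multiset.card_map] at h
  have hcard : Nat.card (C.comap (e : A →+ B)) = Nat.card C :=
    Nat.card_congr (e.toEquiv.subtypeEquiv fun a => by simp)
  rw [hcard] at h
  refine le_trans ?_ h
  rw [← Finset.filter_val]
  exact Finset.card_le_card fun i hi => by simpa using hp i (Finset.mem_filter.1 hi).2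

/-- The decomposition `C₃ ⊕ C_{3q} ≅ (C₃ ⊕ C₃) ⊕ C_q`. -/
def planeProdEquiv {q : ℕ} (h : Nat.Coprime 3 q) :
    ZMod 3 × ZMod (3 * q) ≃+ Plane × ZMod q :=
  ((AddEquiv.refl (ZMod 3)).prodCongr (ZMod.chineseRemainder h).toAddEquiv).trans
    AddEquiv.prodAssoc.symm

/-- Lemma 6(iii): let q ≥ 5 be prime, G = (ℤ/3ℤ) × (ℤ/3qℤ) = H ⊕ K where H is the subgroup
of elements of order dividing 3 and K the subgroup of order q (elements of order dividing q).
Let F be a splitting field of G (char F ∤ 3q and F contains a primitive 3q-th root of unity)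
and S = g₁ ⋯ g_{3q+3} a regular sequence over G. If there are b_i ∈ F^× for
i ∈ I_{S_H} ∪ I_{S_K} with ∏_{i ∈ I_{S_H} ∪ I_{S_K}} (X^{g_i} − b_i) = 0 in FG,
then Σ(S) = G. -/
theorem basis_of_group_algebra_vanishing (q : ℕ) (hq : q.Prime) (hq5 : 5 ≤ q)
    (F : Type*) [Field F]
    (hchar : ¬ (ringChar F ∣ 3 * q)) (hroot : ∃ ζ : F, IsPrimitiveRoot ζ (3 * q))
    (g : Fin (3 * q + 3) → ZMod 3 × ZMod (3 * q))
    (hreg : IsRegularSeq (Finset.univ.val.map g))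
    (IH IK : Finset (Fin (3 * q + 3)))
    (hIH : IH = Finset.univ.filter (fun i => (3 : ℕ) • g i = 0))
    (hIK : IK = Finset.univ.filter (fun i => (q : ℕ) • g i = 0))
    (b : Fin (3 * q + 3) → F) (hb : ∀ i ∈ IH ∪ IK, b i ≠ 0)
    (hprod : ∏ i ∈ IH ∪ IK,
        (AddMonoidAlgebra.of' F (ZMod 3 × ZMod (3 * q)) (g i)
          - algebraMap F (AddMonoidAlgebra F (ZMod 3 × ZMod (3 * q))) (b i)) = 0) :
    subSums (Finset.univ.val.map g) = Set.univ := by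
  have : Fact q.Prime := ⟨hq⟩
  have hcop : Nat.Coprime 3 q := (Nat.coprime_primes Nat.prime_three hq).2 (by omega)
  let e := planeProdEquiv hcop
  let h := fun i => (e (g i)).1
  let k := fun i => (e (g i)).2
  have h3 (a : Plane) : 3 • a = 0 := by
    ext <;> simp <;> exact Or.inl rfl
  have hIH' : IH = Finset.univ.filter fun i => k i = 0 := by
    rw [hIH]
    refine Finset.filter_congr fun i _ => ?_
    rw [← e.map_eq_zero_iff, _root_.map_nsmul, Prod.ext_iff, Prod.smul_fst, Prod.smul_snd, h3,
      nsmul_eq_mul, Prod.snd_zero, mul_eq_zero]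
    have h30 : ((3 : ℕ) : ZMod q) ≠ 0 := by
      rw [Ne, ZMod.natCast_eq_zero_iff, Nat.dvd_prime Nat.prime_three]
      omega
    exact ⟨fun hz => hz.2.resolve_left h30, fun hz => ⟨rfl, Or.inr hz⟩⟩
  have hIK' : IK = Finset.univ.filter fun i => h i = 0 := by
    rw [hIK]
    refine Finset.filter_congr fun i _ => ?_
    rw [← e.map_eq_zero_iff, _root_.map_nsmul, Prod.ext_iff, Prod.smul_fst, Prod.smul_snd]
    have hq1 : q • (e (g i)).2 = 0 := by simp
    rw [hq1]
    refine ⟨fun hz => ?_, fun hz => ⟨by rw [show (e (g i)).1 = 0 from hz, smul_zero]; rfl, rfl⟩⟩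
    have h1 := Nat.dvd_gcd (addOrderOf_dvd_of_nsmul_eq_zero (h3 (h i)))
      (addOrderOf_dvd_of_nsmul_eq_zero hz.1)
    rwa [hcop.gcd_eq_one, Nat.dvd_one, AddMonoid.addOrderOf_eq_one_iff] at h1
  have hcardP : Nat.card (⊤ : AddSubgroup Plane) = 9 := by
    rw [Nat.card_congr AddSubgroup.topEquiv.toEquiv]; simp
  have hcard (A : AddSubgroup Plane) (B : AddSubgroup (ZMod q)) :
      Nat.card (A.prod B) = Nat.card A * Nat.card B := by
    rw [Nat.card_congr (AddSubgroup.prodEquiv A B).toEquiv, Nat.card_prod]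
  have hbot (A : AddSubgroup Plane) : A.prod (⊥ : AddSubgroup (ZMod q)) ≠ ⊤ := by
    intro htop
    have h1 : ((0, 1) : Plane × ZMod q) ∈ A.prod (⊥ : AddSubgroup (ZMod q)) := by simp [htop]
    exact one_ne_zero (AddSubgroup.mem_bot.1 (AddSubgroup.mem_prod.1 h1).2)
  have hH : (Finset.univ.filter fun i => k i = 0).card ≤ 8 := by
    have := hreg.card_filter_le e (AddSubgroup.prod ⊤ ⊥) (hbot _) (fun i => k i = 0)
      fun i hi => AddSubgroup.mem_prod.2 ⟨AddSubgroup.mem_top _, hi⟩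
    rwa [hcard, hcardP, AddSubgroup.card_bot] at this
  have hK : (Finset.univ.filter fun i => h i = 0).card ≤ q - 1 := by
    have := hreg.card_filter_le e (AddSubgroup.prod ⊥ ⊤) (by
        intro htop
        have h1 : (((1, 0), 0) : Plane × ZMod q) ∈
          AddSubgroup.prod (⊥ : AddSubgroup Plane) (⊤ : AddSubgroup (ZMod q)) := by rw [htop]; trivial
        exact one_ne_zero (congrArg Prod.fst (AddSubgroup.mem_bot.1 (AddSubgroup.mem_prod.1 h1).1)))
      (fun i => h i = 0) fun i hi => AddSubgroup.mem_prod.2 ⟨hi, AddSubgroup.mem_top _⟩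
    rw [hcard, AddSubgroup.card_bot, Nat.card_congr AddSubgroup.topEquiv.toEquiv] at this
    simpa using this
  have hne (i) (hk : k i = 0) : h i ≠ 0 := by
    intro hh
    have := hreg.card_filter_le e (AddSubgroup.prod ⊥ ⊥) (hbot _) (fun j => j = i)
      fun j hj => AddSubgroup.mem_prod.2 (hj ▸ ⟨hh, hk⟩)
    rw [hcard, AddSubgroup.card_bot, AddSubgroup.card_bot, Finset.filter_eq'] at this
    simp at this
  have h2 (a : Plane) (ha : a ≠ 0) :
      ((Finset.univ.filter fun i => k i = 0).filter fun i => h i = a ∨ h i = -a).card ≤ 2 := by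
    have := hreg.card_filter_le e (AddSubgroup.prod (AddSubgroup.zmultiples a) ⊥) (hbot _)
      (fun i => k i = 0 ∧ (h i = a ∨ h i = -a)) fun i hi => AddSubgroup.mem_prod.2 ⟨by
        rcases hi.2 with h1 | h1
        · exact h1.symm ▸ AddSubgroup.mem_zmultiples a
        · exact (show (e (g i)).1 = -a from h1).symm ▸ neg_mem (AddSubgroup.mem_zmultiples a), hi.1⟩
    rw [hcard, AddSubgroup.card_bot, Nat.card_zmultiples,
      addOrderOf_eq_prime (h3 a) ha] at this
    rwa [Finset.filter_filter]
  obtain ⟨ζ, hζ⟩ := hroot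
  have hω : IsPrimitiveRoot (ζ ^ q) 3 := hζ.pow (by omega) (mul_comm _ _)
  have hη : IsPrimitiveRoot (ζ ^ 3) q := hζ.pow (by omega) rfl
  obtain ⟨c, hc⟩ := exists_dot_cover hω.zmodChar_injective hη.zmodChar_injective IH IK
    (by rw [hIK']; omega) h k (fun i hi => by simpa [hIH'] using hi)
    (fun i hi => by simpa [hIK'] using hi)
    (fun i hi hk => hne i hk (by simpa [hIK'] using hi)) b (fun χ => by
      have h1 := congrArg (AddMonoidAlgebra.lift F F _
        (χ.comp (AddMonoidHom.toMultiplicative (e : _ →+ Plane × ZMod q)))) hprod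
      rw [map_prod, _root_.map_zero, Finset.prod_eq_zero_iff] at h1
      obtain ⟨i, hi, h1⟩ := h1
      rw [map_sub, AddMonoidAlgebra.lift_of', AlgHom.commutes, sub_eq_zero] at h1
      exact ⟨i, Finset.mem_union.1 hi, h1⟩)
  rw [hIH'] at hc
  have hsum := Plane.exists_subset_sum_of_cover (Finset.univ.filter fun i => k i = 0) h c
    (fun i hi => hne i (Finset.mem_filter.1 hi).2) h2 hc
  refine Set.eq_univ_of_forall fun x => ?_
  obtain ⟨J, hJne, hJh, hJk⟩ := exists_nonempty_subset_sum_eq hq5 (by simp) h k hH hK hsum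
    (e x).1 (e x).2
  refine ⟨J.val.map g, Multiset.map_le_map (Finset.val_le_iff.2 (Finset.subset_univ J)), ?_, ?_⟩
  · simpa using hJne.ne_empty
  · apply e.injective
    change e (∑ j ∈ J, g j) = e x
    rw [map_sum]
    exact Prod.ext (by rw [Prod.fst_sum]; exact hJh) (by rw [Prod.snd_sum]; exact hJk)
end

section
/- Let G be a finite abelian group, F a field, and S = g_1 · … · g_ℓ a sequence over G. Suppose α = (X^{g_1} − a_1) · … · (X^{g_ℓ} − a_ℓ) ≠ 0 in the group algebra FG for some a_1, …, a_ℓ ∈ F^×, and let H = L_α = {g ∈ G : α·(X^g − a) = 0 for some a ∈ F^×}. Then there exists g_0 ∈ G such that Σ(S) ⊇ (g_0 + H) \ {0}; moreover, for every h ∈ H, the sequence S·h obtained by appending the term h to S satisfies Σ(S·h) ⊇ g_0 + H. -/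
section GroupAlgebra

variable {G F : Type*} [AddCommGroup G] [Field F]

theorem AddMonoidAlgebra.coeff_mul_of'_sub_algebraMap (β : AddMonoidAlgebra F G) (x y : G) (c : F) :
    (β * (AddMonoidAlgebra.of' F G x - algebraMap F (AddMonoidAlgebra F G) c)).coeff y =
      β.coeff (y - x) - c * β.coeff y := by
  have h1 : (β * AddMonoidAlgebra.of' F G x).coeff y = β.coeff (y - x) := by
    rw [AddMonoidAlgebra.of'_apply, AddMonoidAlgebra.coeff_mul_single_eq_coeff_mul (y - x)
      fun _ _ => eq_sub_iff_add_eq.symm, mul_one]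
  rw [mul_sub, mul_comm β (algebraMap _ _ c), ← Algebra.smul_def, ← h1]
  simp

theorem AddMonoidAlgebra.exists_sum_eq_of_coeff_prod_ne_zero {ι : Type*} (s : Finset ι) (g : ι → G)
    (a : ι → F) (y : G)
    (hy : (∏ i ∈ s, (AddMonoidAlgebra.of' F G (g i)
      - algebraMap F (AddMonoidAlgebra F G) (a i))).coeff y ≠ 0) :
    ∃ t ⊆ s, ∑ i ∈ t, g i = y := by
  classical
  induction s using Finset.induction_on generalizing y with
  | empty =>
    refine ⟨∅, subset_rfl, ?_⟩
    by_contra! hne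
    simp only [Finset.sum_empty] at hne
    simp [AddMonoidAlgebra.one_def, hne] at hy
  | insert i s hi ih =>
    rw [Finset.prod_insert hi, mul_comm, AddMonoidAlgebra.coeff_mul_of'_sub_algebraMap] at hy
    by_cases h : (∏ i ∈ s, (AddMonoidAlgebra.of' F G (g i)
        - algebraMap F (AddMonoidAlgebra F G) (a i))).coeff y = 0
    · rw [h, mul_zero, sub_zero] at hy
      obtain ⟨t, hts, ht⟩ := ih _ hy
      refine ⟨insert i t, Finset.insert_subset_insert i hts, ?_⟩
      rw [Finset.sum_insert fun hit => hi (hts hit), ht, add_sub_cancel]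
    · obtain ⟨t, hts, ht⟩ := ih _ h
      exact ⟨t, hts.trans (Finset.subset_insert i s), ht⟩

end GroupAlgebra


open Multiset

/-- Lemma 7: let G be a finite abelian group, F a field and S = g₁ ⋯ g_ℓ a sequence over G.
If α = (X^{g₁} − a₁) ⋯ (X^{g_ℓ} − a_ℓ) ≠ 0 in FG for some a₁, …, a_ℓ ∈ F^×, and
H = L_α = {x ∈ G : α (X^x − a) = 0 for some a ∈ F^×}, then Σ(S) ⊇ (g₀ + H) \ {0} for some
g₀ ∈ G; moreover Σ(S·h) ⊇ g₀ + H for every h ∈ H. -/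
theorem coset_in_subSums (G : Type*) [AddCommGroup G] [Fintype G]
    (F : Type*) [Field F] (ℓ : ℕ) (g : Fin ℓ → G)
    (a : Fin ℓ → F) (ha : ∀ i, a i ≠ 0)
    (α : AddMonoidAlgebra F G)
    (hα : α = ∏ i, (AddMonoidAlgebra.of' F G (g i)
        - algebraMap F (AddMonoidAlgebra F G) (a i)))
    (hα0 : α ≠ 0)
    (H : Set G)
    (hH : H = {x : G | ∃ c : F, c ≠ 0 ∧
        α * (AddMonoidAlgebra.of' F G x - algebraMap F (AddMonoidAlgebra F G) c) = 0}) :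
    ∃ g₀ : G,
      ((fun h => g₀ + h) '' H) \ {0} ⊆ subSums (Finset.univ.val.map g) ∧
      ∀ h ∈ H, (fun h' => g₀ + h') '' H ⊆ subSums (h ::ₘ Finset.univ.val.map g) := by
  have hshift : ∀ x ∈ H, ∃ c : F, c ≠ 0 ∧ ∀ y, α.coeff (y - x) = c * α.coeff y := by
    intro x hx
    rw [hH] at hx
    obtain ⟨c, hc, hx⟩ := hx
    refine ⟨c, hc, fun y => sub_eq_zero.mp ?_⟩
    rw [← AddMonoidAlgebra.coeff_mul_of'_sub_algebraMap, hx]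
    simp
  have hadd : ∀ y, α.coeff y ≠ 0 → ∀ x ∈ H, α.coeff (y + x) ≠ 0 := by
    intro y hy x hx h0
    obtain ⟨c, -, h⟩ := hshift x hx
    have := h (y + x)
    rw [add_sub_cancel_right, h0, mul_zero] at this
    exact hy this
  have hsum : ∀ y, α.coeff y ≠ 0 → ∃ T ≤ Finset.univ.val.map g, T.sum = y := by
    intro y hy
    rw [hα] at hy
    obtain ⟨t, ht, rfl⟩ :=
      AddMonoidAlgebra.exists_sum_eq_of_coeff_prod_ne_zero Finset.univ g a y hy
    exact ⟨t.val.map g, Multiset.map_le_map (Finset.val_le_iff.mpr ht), rfl⟩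
  have hsub : ∀ y, α.coeff y ≠ 0 → y ≠ 0 → y ∈ subSums (Finset.univ.val.map g) := by
    intro y hy hy0
    obtain ⟨T, hT, rfl⟩ := hsum y hy
    exact ⟨T, hT, fun h => hy0 (by rw [h, Multiset.sum_zero]), rfl⟩
  obtain ⟨g₀, hg₀⟩ : ∃ y, α.coeff y ≠ 0 := by
    by_contra! h
    exact hα0 (AddMonoidAlgebra.ext (Finsupp.ext h))
  refine ⟨g₀, ?_, ?_⟩
  · rintro _ ⟨⟨x, hx, rfl⟩, hx0⟩
    exact hsub _ (hadd g₀ hg₀ x hx) hx0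
  · rintro h hh _ ⟨x, hx, rfl⟩
    have hne := hadd g₀ hg₀ x hx
    by_cases hx0 : g₀ + x = 0
    · obtain ⟨c, hc, hch⟩ := hshift h hh
      have hneg : α.coeff (-h) ≠ 0 := by
        rw [← zero_sub, hch]
        exact mul_ne_zero hc (hx0 ▸ hne)
      obtain ⟨T, hT, hTs⟩ := hsum _ hneg
      refine ⟨h ::ₘ T, Multiset.cons_le_cons h hT, Multiset.cons_ne_zero, ?_⟩
      simp [hTs, hx0]
    · obtain ⟨T, hT, hT0, hTs⟩ := hsub _ hne hx0
      exact ⟨T, hT.trans (Multiset.le_cons_self _ h), hT0, hTs⟩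
end
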